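/- arXiv:1103.1998 — 7 statements merged into one kernel-verified Lean document; each statement's English description precedes it below -/
import Mathlib

section
/- Let μ be a probability measure on ℝⁿ. Assume that for every integer k ≥ 1 there exists a constant C_k such that for every smooth function G : ℝⁿ → ℝ which is bounded together with all of its derivatives, one has ‖∫_{ℝⁿ} D^{(k)}G(x) μ(dx)‖ ≤ C_k ‖G‖_∞, where D^{(k)}G denotes the k-th total derivative of G (a k-linear-form-valued function) and ‖G‖_∞ the supremum norm of G. Then μ has a smooth density with respect to Lebesgue measure on ℝⁿ, i.e. there exists an infinitely differentiable function ρ : ℝⁿ → [0,∞) such that μ equals the Lebesgue measure with density ρ. -/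
open MeasureTheory

open scoped ContDiff FourierTransform RealInnerProductSpace Manifold

section Uniqueness

variable {E : Type*} [NormedAddCommGroup E] [NormedSpace ℝ E] [FiniteDimensional ℝ E]
  [MeasurableSpace E] [BorelSpace E]

/-- An inequality between the integrals of smooth compactly supported functions gives an inequality
between the measures of open sets. -/
theorem MeasureTheory.measure_isOpen_le_of_integral_contDiff_le {μ ν : Measure E}
    [μ.Regular] [ν.Regular]
    (h : ∀ g : E → ℝ, ContDiff ℝ ∞ g → HasCompactSupport g → ∫ x, g x ∂μ ≤ ∫ x, g x ∂ν)
    {U : Set E} (hU : IsOpen U) : μ U ≤ ν U := by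
  rw [hU.measure_eq_iSup_isCompact]
  refine iSup₂_le fun K hKU ↦ iSup_le fun hK ↦ ?_
  obtain ⟨V, hV, hKV, hVU, hVc⟩ := exists_open_between_and_isCompact_closure hK hU hKU
  obtain ⟨g, hg, hgr, hgs, hg1⟩ :=
    exists_contMDiff_support_eq_eq_one_iff (n := ⊤) 𝓘(ℝ, E) hV hK.isClosed hKV
  have hgc : HasCompactSupport g := by
    rw [HasCompactSupport, tsupport, hgs]
    exact hVc
  have hg0 : ∀ x, 0 ≤ g x := fun x ↦ (hgr ⟨x, rfl⟩).1
  have hgle : ∀ x, g x ≤ 1 := fun x ↦ (hgr ⟨x, rfl⟩).2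
  have hint (m : Measure E) [m.Regular] : Integrable g m :=
    hg.continuous.integrable_of_hasCompactSupport hgc
  calc μ K = ∫⁻ x, K.indicator 1 x ∂μ := (lintegral_indicator_one hK.measurableSet).symm
    _ ≤ ∫⁻ x, ENNReal.ofReal (g x) ∂μ := by
        refine lintegral_mono fun x ↦ ?_
        by_cases hx : x ∈ K
        · simp [hx, (hg1 x).1 hx]
        · simp [hx]
    _ = ENNReal.ofReal (∫ x, g x ∂μ) :=
        (ofReal_integral_eq_lintegral_ofReal (hint μ) (.of_forall hg0)).symm
    _ ≤ ENNReal.ofReal (∫ x, g x ∂ν) := ENNReal.ofReal_le_ofReal (h g hg.contDiff hgc)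
    _ = ∫⁻ x, ENNReal.ofReal (g x) ∂ν :=
        ofReal_integral_eq_lintegral_ofReal (hint ν) (.of_forall hg0)
    _ ≤ ∫⁻ x, U.indicator 1 x ∂ν := by
        refine lintegral_mono fun x ↦ ?_
        by_cases hx : x ∈ U
        · simpa [hx] using hgle x
        · have : g x = 0 := by
            rw [← Function.notMem_support, hgs]
            exact fun hxV ↦ hx (hVU (subset_closure hxV))
          simp [this]
    _ = ν U := lintegral_indicator_one hU.measurableSet

/-- Two regular measures agreeing on smooth compactly supported functions are equal. -/
theorem MeasureTheory.Measure.ext_of_integral_contDiff {μ ν : Measure E} [μ.Regular] [ν.Regular]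
    (h : ∀ g : E → ℝ, ContDiff ℝ ∞ g → HasCompactSupport g → ∫ x, g x ∂μ = ∫ x, g x ∂ν) :
    μ = ν :=
  Measure.OuterRegular.ext_isOpen fun _ hU ↦ le_antisymm
    (measure_isOpen_le_of_integral_contDiff_le (fun g hg hgc ↦ (h g hg hgc).le) hU)
    (measure_isOpen_le_of_integral_contDiff_le (fun g hg hgc ↦ (h g hg hgc).ge) hU)

/-- A measure represented against test functions by a continuous function `ρ` has density `ρ`,
and `ρ` is nonnegative. -/
theorem MeasureTheory.Measure.eq_withDensity_of_integral_contDiff {μ ν : Measure E}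
    [μ.Regular] [ν.Regular] [ν.IsOpenPosMeasure] {ρ : E → ℝ} (hρ : Continuous ρ)
    (h : ∀ g : E → ℝ, ContDiff ℝ ∞ g → HasCompactSupport g → ∫ x, g x ∂μ = ∫ x, g x * ρ x ∂ν) :
    (∀ x, 0 ≤ ρ x) ∧ μ = ν.withDensity fun x ↦ ENNReal.ofReal (ρ x) := by
  have hnn : ∀ x, 0 ≤ ρ x := by
    by_contra! ⟨x, hx⟩
    obtain ⟨V, hV, hKV, hVU, hVc⟩ := exists_open_between_and_isCompact_closure
      (isCompact_singleton (x := x)) (isOpen_lt hρ continuous_const)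
      (Set.singleton_subset_iff.2 hx)
    obtain ⟨g, hgs, hg, hgr⟩ := hV.exists_contDiff_support_eq (n := ⊤)
    have hgc : HasCompactSupport g := by
      rw [HasCompactSupport, tsupport, hgs]
      exact hVc
    have hg0 : ∀ y, 0 ≤ g y := fun y ↦ (hgr ⟨y, rfl⟩).1
    have hgx : g x ≠ 0 := by
      rw [← Function.mem_support, hgs]
      exact hKV rfl
    have hpos : 0 < ∫ y, -(g y * ρ y) ∂ν := by
      refine Continuous.integral_pos_of_hasCompactSupport_nonneg_nonzero (x := x)
        (hg.continuous.mul hρ).neg (hgc.mul_right (f' := ρ)).neg (fun y ↦ ?_) ?_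
      · by_cases hy : y ∈ V
        · have := hVU (subset_closure hy)
          exact neg_nonneg.2 (mul_nonpos_of_nonneg_of_nonpos (hg0 y) (le_of_lt this))
        · have : g y = 0 := by rwa [← Function.notMem_support, hgs]
          simp [this]
      · simpa using ⟨hgx, hx.ne⟩
    rw [integral_neg, ← h g hg hgc] at hpos
    linarith [integral_nonneg (μ := μ) (f := g) hg0]
  refine ⟨hnn, ?_⟩
  have : IsLocallyFiniteMeasure (ν.withDensity fun x ↦ ENNReal.ofReal (ρ x)) :=
    IsLocallyFiniteMeasure.withDensity_ofReal hρ
  refine Measure.ext_of_integral_contDiff fun g hg hgc ↦ ?_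
  rw [h g hg hgc, integral_withDensity_eq_integral_toReal_smul (by fun_prop) (by simp)]
  simp [ENNReal.toReal_ofReal, hnn, mul_comm]

end Uniqueness

section Decay

variable {E : Type*} [NormedAddCommGroup E] [InnerProductSpace ℝ E]

/-- The iterated derivatives of a plane wave with a bounded profile are bounded. -/
theorem norm_iteratedFDeriv_comp_innerSL_le {f : ℝ → ℝ} (hf : ContDiff ℝ ∞ f) {i : ℕ}
    (hb : ∀ y, |iteratedDeriv i f y| ≤ 1) (t x : E) :
    ‖iteratedFDeriv ℝ i (f ∘ innerSL ℝ t) x‖ ≤ ‖t‖ ^ i := by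
  rw [(innerSL ℝ t).iteratedFDeriv_comp_right hf x (by exact_mod_cast le_top)]
  refine (ContinuousMultilinearMap.norm_compContinuousLinearMap_le _ _).trans ?_
  rw [norm_iteratedFDeriv_eq_norm_iteratedDeriv]
  simpa using mul_le_mul_of_nonneg_right (hb (innerSL ℝ t x)) (by positivity : 0 ≤ ‖t‖ ^ i)

theorem iteratedFDeriv_comp_innerSL_apply_self {f : ℝ → ℝ} (hf : ContDiff ℝ ∞ f) (i : ℕ)
    (t x : E) :
    iteratedFDeriv ℝ i (f ∘ innerSL ℝ t) x (fun _ ↦ t) =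
      (‖t‖ ^ i) ^ 2 * iteratedDeriv i f ⟪t, x⟫ := by
  rw [(innerSL ℝ t).iteratedFDeriv_comp_right hf x (by exact_mod_cast le_top)]
  simp [iteratedFDeriv_apply_eq_iteratedDeriv_mul_prod]
  left; ring

variable [MeasurableSpace E] [BorelSpace E] [SecondCountableTopology E]

/-- Testing an integration by parts inequality of order `k` against a plane wave. -/
theorem pow_mul_abs_integral_le {μ : Measure E} [IsProbabilityMeasure μ] {k : ℕ} {C : ℝ}
    (h : ∀ G : E → ℝ, ContDiff ℝ ∞ G → (∀ i : ℕ, ∃ B : ℝ, ∀ x, ‖iteratedFDeriv ℝ i G x‖ ≤ B) →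
      ‖∫ x, iteratedFDeriv ℝ k G x ∂μ‖ ≤ C * ⨆ x, |G x|)
    {f : ℝ → ℝ} (hf : ContDiff ℝ ∞ f) (hb : ∀ i y, |iteratedDeriv i f y| ≤ 1) (t : E) :
    ‖t‖ ^ k * |∫ x, iteratedDeriv k f ⟪t, x⟫ ∂μ| ≤ |C| := by
  have hsmooth : ContDiff ℝ ∞ (f ∘ innerSL ℝ t) := hf.comp (innerSL ℝ t).contDiff
  have hbound (i : ℕ) (x : E) := norm_iteratedFDeriv_comp_innerSL_le hf (hb i) t x
  have hint : Integrable (iteratedFDeriv ℝ k (f ∘ innerSL ℝ t)) μ :=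
    .of_bound (hsmooth.continuous_iteratedFDeriv (by exact_mod_cast le_top)).aestronglyMeasurable
      _ (.of_forall (hbound k))
  have hsup : |(⨆ x, |(f ∘ innerSL ℝ t) x|)| ≤ 1 := by
    rw [abs_of_nonneg (Real.iSup_nonneg fun _ ↦ abs_nonneg _)]
    exact Real.iSup_le (fun x ↦ by simpa using hb 0 (innerSL ℝ t x)) zero_le_one
  have hC : ‖∫ x, iteratedFDeriv ℝ k (f ∘ innerSL ℝ t) x ∂μ‖ ≤ |C| := by
    refine (h _ hsmooth fun i ↦ ⟨_, hbound i⟩).trans ((le_abs_self _).trans ?_)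
    rw [abs_mul]
    exact mul_le_of_le_one_right (abs_nonneg _) hsup
  have key : (‖t‖ ^ k) ^ 2 * |∫ x, iteratedDeriv k f ⟪t, x⟫ ∂μ| ≤ |C| * ‖t‖ ^ k := by
    have := (∫ x, iteratedFDeriv ℝ k (f ∘ innerSL ℝ t) x ∂μ).le_opNorm fun _ ↦ t
    rw [ContinuousMultilinearMap.integral_apply hint] at this
    simp only [iteratedFDeriv_comp_innerSL_apply_self hf, integral_const_mul, Real.norm_eq_abs,
      abs_mul, abs_pow, abs_norm, Finset.prod_const, Finset.card_univ, Fintype.card_fin] at this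
    exact this.trans (mul_le_mul_of_nonneg_right hC (by positivity))
  rcases (by positivity : 0 ≤ ‖t‖ ^ k).eq_or_lt with h0 | h0
  · simp [← h0]
  · refine le_of_mul_le_mul_right ?_ h0
    linarith

/-- The characteristic function of a measure satisfying integration by parts inequalities of all
orders decays rapidly. -/
theorem exists_pow_mul_norm_charFun_le {μ : Measure E} [IsProbabilityMeasure μ]
    (h : ∀ k : ℕ, 1 ≤ k → ∃ C : ℝ, ∀ G : E → ℝ, ContDiff ℝ ∞ G →
      (∀ i : ℕ, ∃ B : ℝ, ∀ x, ‖iteratedFDeriv ℝ i G x‖ ≤ B) →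
      ‖∫ x, iteratedFDeriv ℝ k G x ∂μ‖ ≤ C * ⨆ x, |G x|) (k : ℕ) :
    ∃ C : ℝ, ∀ t : E, ‖t‖ ^ k * ‖charFun μ t‖ ≤ C := by
  obtain ⟨C, hC⟩ := h (2 * (k + 1)) (by omega)
  refine ⟨1 + 2 * |C|, fun t ↦ ?_⟩
  have hcos := pow_mul_abs_integral_le hC Real.contDiff_cos Real.abs_iteratedDeriv_cos_le_one t
  have hsin := pow_mul_abs_integral_le hC Real.contDiff_sin Real.abs_iteratedDeriv_sin_le_one t
  simp only [Real.iteratedDeriv_even_cos, Real.iteratedDeriv_even_sin, Pi.mul_apply, Pi.pow_apply,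
    Pi.neg_apply, Pi.one_apply, integral_const_mul, abs_mul, abs_pow, abs_neg, abs_one, one_pow,
    one_mul] at hcos hsin
  have hint : Integrable (fun x : E ↦ Complex.exp (⟪x, t⟫ * Complex.I)) μ :=
    .of_bound (by fun_prop) 1 (.of_forall fun x ↦ by simp [Complex.norm_exp_ofReal_mul_I])
  have hre : (charFun μ t).re = ∫ x, Real.cos ⟪t, x⟫ ∂μ := by
    rw [charFun_apply, ← RCLike.re_eq_complex_re, ← integral_re hint]
    simp [Complex.exp_ofReal_mul_I_re, real_inner_comm]
  have him : (charFun μ t).im = ∫ x, Real.sin ⟪t, x⟫ ∂μ := by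
    rw [charFun_apply, ← RCLike.im_eq_complex_im, ← integral_im hint]
    simp [Complex.exp_ofReal_mul_I_im, real_inner_comm]
  rw [← hre] at hcos
  rw [← him] at hsin
  have heven : ‖t‖ ^ (2 * (k + 1)) * ‖charFun μ t‖ ≤ 2 * |C| := by
    have := mul_le_mul_of_nonneg_left (Complex.norm_le_abs_re_add_abs_im (charFun μ t))
      (by positivity : 0 ≤ ‖t‖ ^ (2 * (k + 1)))
    linarith
  have hpow : ‖t‖ ^ k ≤ 1 + ‖t‖ ^ (2 * (k + 1)) := by
    rcases le_total ‖t‖ 1 with ht | ht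
    · linarith [pow_le_one₀ (n := k) (norm_nonneg t) ht,
        (by positivity : 0 ≤ ‖t‖ ^ (2 * (k + 1)))]
    · linarith [pow_le_pow_right₀ ht (by omega : k ≤ 2 * (k + 1))]
  calc ‖t‖ ^ k * ‖charFun μ t‖ ≤ (1 + ‖t‖ ^ (2 * (k + 1))) * ‖charFun μ t‖ := by gcongr
    _ ≤ 1 + 2 * |C| := by linarith [norm_charFun_le_one (μ := μ) t]

end Decay

section Inversion

variable {E : Type*} [NormedAddCommGroup E] [InnerProductSpace ℝ E] [FiniteDimensional ℝ E]
  [MeasurableSpace E] [BorelSpace E]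

/-- A continuous function all of whose products with powers of the norm are bounded is integrable
against all powers of the norm. -/
theorem integrable_pow_mul_norm_of_forall_bounded {f : E → ℂ} (hf : Continuous f)
    (h : ∀ k : ℕ, ∃ C : ℝ, ∀ t, ‖t‖ ^ k * ‖f t‖ ≤ C) (k : ℕ) :
    Integrable (fun t ↦ ‖t‖ ^ k * ‖f t‖) := by
  set d := Module.finrank ℝ E + 1
  choose C hC using h
  have hd : Integrable (fun t : E ↦ (1 + ‖t‖) ^ (-(d : ℝ))) :=
    integrable_one_add_norm (by simp [d])
  refine (hd.const_mul (2 ^ (d - 1) * (C k + C (k + d)))).mono' (by fun_prop)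
    (.of_forall fun t ↦ ?_)
  rw [Real.rpow_neg (by positivity), Real.rpow_natCast, ← div_eq_mul_inv,
    le_div_iff₀ (by positivity), Real.norm_of_nonneg (by positivity)]
  have hadd := add_pow_le zero_le_one (norm_nonneg t) d
  calc ‖t‖ ^ k * ‖f t‖ * (1 + ‖t‖) ^ d
      ≤ ‖t‖ ^ k * ‖f t‖ * (2 ^ (d - 1) * (1 ^ d + ‖t‖ ^ d)) := by gcongr
    _ = 2 ^ (d - 1) * (‖t‖ ^ k * ‖f t‖ + ‖t‖ ^ (k + d) * ‖f t‖) := by ring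
    _ ≤ 2 ^ (d - 1) * (C k + C (k + d)) := by gcongr <;> apply hC

/-- Fourier inversion for a finite measure, tested against a Schwartz function. -/
theorem integral_eq_integral_mul_fourier_charFun {μ : Measure E} [IsFiniteMeasure μ]
    (hφ : Integrable fun t : E ↦ charFun μ ((2 * Real.pi) • t)) (g : SchwartzMap E ℂ) :
    ∫ x, g x ∂μ = ∫ x, g x * 𝓕 (fun t : E ↦ charFun μ ((2 * Real.pi) • t)) x := by
  have hchar (t : E) : charFun μ ((2 * Real.pi) • t) =
      VectorFourier.fourierIntegral Real.fourierChar μ (innerₗ E) 1 (-t) := by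
    rw [charFun_eq_fourierIntegral', smul_smul, neg_mul, inv_mul_cancel₀ (by positivity),
      neg_one_smul]
  have hflip : (innerₗ E).flip = innerₗ E := by
    ext x y
    exact real_inner_comm _ _
  have hcont : Continuous fun p : E × E ↦ innerₗ E p.1 p.2 := continuous_inner
  have h1 : ∫ x, g x * 𝓕 (fun t : E ↦ charFun μ ((2 * Real.pi) • t)) x =
      ∫ t, 𝓕 (g : E → ℂ) t * charFun μ ((2 * Real.pi) • t) := by
    have := VectorFourier.integral_fourierIntegral_smul_eq_flip (L := innerₗ E)
      Real.continuous_fourierChar hcont g.integrable (μ := volume) hφ (ν := volume)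
    rw [hflip] at this
    exact this.symm
  have h2 := VectorFourier.integral_fourierIntegral_smul_eq_flip (L := innerₗ E) (μ := volume)
    (ν := μ) (f := 𝓕⁻ (g : E → ℂ)) (g := 1) Real.continuous_fourierChar hcont
    (by rw [← SchwartzMap.fourierInv_coe]; exact (𝓕⁻ g).integrable)
    (integrable_const (1 : ℂ))
  rw [hflip] at h2
  have h3 : VectorFourier.fourierIntegral Real.fourierChar volume (innerₗ E) (𝓕⁻ (g : E → ℂ)) =
      g := by
    change 𝓕 (𝓕⁻ (g : E → ℂ)) = g
    rw [← SchwartzMap.fourierInv_coe, ← SchwartzMap.fourier_coe,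
      FourierTransform.fourier_fourierInv_eq]
  rw [h1, ← integral_neg_eq_self _ volume]
  simp only [hchar, neg_neg, ← Real.fourierInv_eq_fourier_neg]
  simpa [h3] using h2

end Inversion

/-- **Lemma 1 (smooth density criterion).** If a probability measure `μ` on `ℝⁿ` satisfies
`‖∫ D^(k) G dμ‖ ≤ C_k ‖G‖_∞` for every smooth function `G` that is bounded together with all
its derivatives, then `μ` has a smooth density with respect to Lebesgue measure. -/
theorem smooth_density_of_integration_by_parts
    (n : ℕ) (μ : Measure (EuclideanSpace ℝ (Fin n))) [IsProbabilityMeasure μ]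
    (h : ∀ k : ℕ, 1 ≤ k → ∃ C : ℝ,
      ∀ G : EuclideanSpace ℝ (Fin n) → ℝ, ContDiff ℝ (⊤ : ℕ∞) G →
        (∀ i : ℕ, ∃ B : ℝ, ∀ x, ‖iteratedFDeriv ℝ i G x‖ ≤ B) →
        ‖∫ x, iteratedFDeriv ℝ k G x ∂μ‖ ≤ C * (⨆ x, |G x|)) :
    ∃ ρ : EuclideanSpace ℝ (Fin n) → ℝ, ContDiff ℝ (⊤ : ℕ∞) ρ ∧ (∀ x, 0 ≤ ρ x) ∧
      μ = volume.withDensity (fun x => ENNReal.ofReal (ρ x)) := by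
  set ψ : EuclideanSpace ℝ (Fin n) → ℂ := fun t ↦ charFun μ ((2 * Real.pi) • t) with hψ
  have hψc : Continuous ψ := (continuous_charFun (μ := μ)).comp (continuous_const_smul _)
  have hdecay (k : ℕ) : ∃ C : ℝ, ∀ t, ‖t‖ ^ k * ‖ψ t‖ ≤ C := by
    obtain ⟨C, hC⟩ := exists_pow_mul_norm_charFun_le h k
    refine ⟨C / (2 * Real.pi) ^ k, fun t ↦ ?_⟩
    rw [le_div_iff₀ (by positivity)]
    have := hC ((2 * Real.pi) • t)
    rw [norm_smul, Real.norm_of_nonneg (by positivity), mul_pow] at this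
    linarith
  have hint := integrable_pow_mul_norm_of_forall_bounded hψc hdecay
  have hψi : Integrable ψ :=
    (integrable_norm_iff hψc.aestronglyMeasurable).1 (by simpa using hint 0)
  have hsmooth : ContDiff ℝ ∞ (𝓕 ψ) := Real.contDiff_fourier fun k _ ↦ hint k
  have hρ : ContDiff ℝ ∞ fun x ↦ (𝓕 ψ x).re := Complex.reCLM.contDiff.comp hsmooth
  refine ⟨_, hρ, Measure.eq_withDensity_of_integral_contDiff hρ.continuous fun g hg hgc ↦ ?_⟩
  have hgc' : HasCompactSupport fun x ↦ (g x : ℂ) := hgc.comp_left Complex.ofReal_zero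
  have hg' : ContDiff ℝ ∞ fun x ↦ (g x : ℂ) := Complex.ofRealCLM.contDiff.comp hg
  have key := integral_eq_integral_mul_fourier_charFun hψi (hgc'.toSchwartzMap hg')
  have hre := congrArg Complex.re key
  simp only [HasCompactSupport.toSchwartzMap_toFun, integral_complex_ofReal,
    Complex.ofReal_re] at hre
  rw [hre, ← RCLike.re_eq_complex_re, ← integral_re]
  · simp [hψ]
  · exact (hg'.continuous.mul hsmooth.continuous).integrable_of_hasCompactSupport hgc'.mul_right
end

section
/- Fix N ∈ ℕ and positive reals δt_1,…,δt_N. Let μ be the Gaussian product measure on ℝ^N under which the coordinates δw_1,…,δw_N are independent centered Gaussians with variances δt_1,…,δt_N; write ∂_k for the partial derivative with respect to the k-th coordinate. Let X : ℝ^N → ℝⁿ be smooth and define the n×n matrix-valued map M by M_{ij}(w) = Σ_{k=1}^N ∂_k X_i(w) ∂_k X_j(w) δt_k. Assume that M(w) is invertible for every w ∈ ℝ^N, that ∫ |∂_{k_1}⋯∂_{k_m} X_i(w)|^p μ(dw) < ∞ for every p > 1, every m ≥ 0, every choice of indices k_1,…,k_m ∈ {1,…,N} and every i, and that ∫ ‖M(w)^{-1}‖^p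 μ(dw) < ∞ for every p > 1. Then the pushforward measure of μ under X has a smooth density with respect to Lebesgue measure on ℝⁿ. -/
open MeasureTheory ProbabilityTheory

theorem pi_gaussianReal_eq_withDensity {ι : Type*} [Fintype ι] (v : ι → NNReal)
    (hv : ∀ k, v k ≠ 0) :
    Measure.pi (fun k => gaussianReal 0 (v k)) =
      (volume : Measure (ι → ℝ)).withDensity
        (fun w => ENNReal.ofReal (∏ k, gaussianPDFReal 0 (v k) (w k))) := by
  refine Measure.pi_eq fun s hs => ?_
  have hint : Integrable (fun w : ι → ℝ => ∏ k, gaussianPDFReal 0 (v k) (w k)) :=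
    Integrable.fintype_prod fun k => integrable_gaussianPDFReal 0 (v k)
  rw [withDensity_apply _ (MeasurableSet.univ_pi hs),
    ← ofReal_integral_eq_lintegral_ofReal hint.integrableOn
      (ae_of_all _ fun w => Finset.prod_nonneg fun k _ => gaussianPDFReal_nonneg _ _ _),
    volume_pi, Measure.restrict_pi_pi,
    integral_fintype_prod_eq_prod (fun k x => gaussianPDFReal 0 (v k) x),
    ENNReal.ofReal_prod_of_nonneg
      fun k _ => integral_nonneg fun x => gaussianPDFReal_nonneg _ _ _]
  exact Finset.prod_congr rfl fun k _ => (gaussianReal_apply_eq_integral 0 (hv k) (s k)).symm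

theorem hasDerivAt_gaussianPDFReal_zero (v : NNReal) (hv : v ≠ 0) (x : ℝ) :
    HasDerivAt (gaussianPDFReal 0 v) (-(x / v) * gaussianPDFReal 0 v x) x := by
  have hv' : (v : ℝ) ≠ 0 := by exact_mod_cast hv
  rw [gaussianPDFReal_def]
  have h : HasDerivAt (fun x : ℝ => -(x - 0) ^ 2 / (2 * v)) (-(x / v)) x := by
    have := ((((hasDerivAt_id x).sub_const 0).pow 2).neg).div_const (2 * (v : ℝ))
    refine this.congr_deriv ?_
    simp; field_simp
  exact (h.exp.const_mul _).congr_deriv (by ring)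

theorem differentiable_prod_gaussianPDFReal {ι : Type*} [Fintype ι] (v : ι → NNReal)
    (hv : ∀ k, v k ≠ 0) :
    Differentiable ℝ (fun w : ι → ℝ => ∏ k, gaussianPDFReal 0 (v k) (w k)) := by
  intro w
  have h (k : ι) : DifferentiableAt ℝ (fun w : ι → ℝ => gaussianPDFReal 0 (v k) (w k)) w :=
    DifferentiableAt.comp (g := gaussianPDFReal 0 (v k)) w
      (hasDerivAt_gaussianPDFReal_zero (v k) (hv k) (w k)).differentiableAt
      (differentiableAt_apply k w)
  classical
  exact (HasFDerivAt.finsetProd (u := Finset.univ)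
    fun k _ => (h k).hasFDerivAt).differentiableAt

theorem fderiv_prod_gaussianPDFReal {ι : Type*} [Fintype ι] [DecidableEq ι] (v : ι → NNReal)
    (hv : ∀ k, v k ≠ 0) (w : ι → ℝ) (k : ι) :
    fderiv ℝ (fun w : ι → ℝ => ∏ k, gaussianPDFReal 0 (v k) (w k)) w (Pi.single k 1) =
      -(w k / v k) * ∏ k, gaussianPDFReal 0 (v k) (w k) := by
  rw [← (differentiable_prod_gaussianPDFReal v hv w).lineDeriv_eq_fderiv]
  have h0 : HasDerivAt (fun t : ℝ => w k + t) 1 0 := by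
    simpa using (hasDerivAt_id (0 : ℝ)).const_add (w k)
  have h := (HasDerivAt.comp (0 : ℝ)
    (by simpa using hasDerivAt_gaussianPDFReal_zero (v k) (hv k) (w k)) h0).mul_const
    (∏ j ∈ Finset.univ.erase k, gaussianPDFReal 0 (v j) (w j))
  refine HasDerivAt.deriv ((h.congr_of_eventuallyEq (.of_forall fun t => ?_)).congr_deriv ?_)
  · simp only [Function.comp_apply]
    rw [← Finset.mul_prod_erase _ _ (Finset.mem_univ k)]
    congr 1
    · simp
    · refine Finset.prod_congr rfl fun j hj => ?_
      simp [Pi.single_eq_of_ne (Finset.ne_of_mem_erase hj)]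
  · rw [← Finset.mul_prod_erase _ _ (Finset.mem_univ k)]
    simp [mul_assoc]

/-- Gaussian integration by parts in the direction of a coordinate. -/
theorem integral_fderiv_single_pi_gaussianReal {ι : Type*} [Fintype ι] [DecidableEq ι]
    (v : ι → NNReal) (hv : ∀ k, v k ≠ 0) (k : ι) {F : (ι → ℝ) → ℂ} (hF : Differentiable ℝ F)
    (hF0 : Integrable F (Measure.pi fun k => gaussianReal 0 (v k)))
    (hF1 : Integrable (fun w => fderiv ℝ F w (Pi.single k 1))
      (Measure.pi fun k => gaussianReal 0 (v k)))
    (hF2 : Integrable (fun w => (w k : ℂ) * F w) (Measure.pi fun k => gaussianReal 0 (v k))) :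
    (v k : ℂ) * ∫ w, fderiv ℝ F w (Pi.single k 1) ∂(Measure.pi fun k => gaussianReal 0 (v k)) =
      ∫ w, (w k : ℂ) * F w ∂(Measure.pi fun k => gaussianReal 0 (v k)) := by
  have hvk : (v k : ℂ) ≠ 0 := by exact_mod_cast hv k
  set p : (ι → ℝ) → ℝ := fun w => ∏ k, gaussianPDFReal 0 (v k) (w k) with hp
  have hpd : Differentiable ℝ p := differentiable_prod_gaussianPDFReal v hv
  have hp0 (w) : 0 ≤ p w := Finset.prod_nonneg fun k _ => gaussianPDFReal_nonneg _ _ _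
  have hpm : Measurable fun w => ENNReal.ofReal (p w) :=
    hpd.continuous.measurable.ennreal_ofReal
  have hfin : ∀ᵐ w ∂(volume : Measure (ι → ℝ)), ENNReal.ofReal (p w) < ⊤ :=
    ae_of_all _ fun w => ENNReal.ofReal_lt_top
  rw [pi_gaussianReal_eq_withDensity v hv] at *
  rw [integrable_withDensity_iff_integrable_smul' hpm hfin] at hF0 hF1 hF2
  rw [integral_withDensity_eq_integral_toReal_smul hpm hfin,
    integral_withDensity_eq_integral_toReal_smul hpm hfin]
  simp only [ENNReal.toReal_ofReal (hp0 _), Complex.real_smul] at hF0 hF1 hF2 ⊢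
  have hpc (w) : fderiv ℝ (fun w => (p w : ℂ)) w (Pi.single k 1) =
      -((w k : ℂ) / v k) * p w := by
    have h1 : HasFDerivAt (fun w => (p w : ℂ)) (Complex.ofRealCLM.comp (fderiv ℝ p w)) w :=
      Complex.ofRealCLM.hasFDerivAt.comp w (hpd w).hasFDerivAt
    rw [h1.fderiv]
    simp [hp, fderiv_prod_gaussianPDFReal v hv]
  have key := integral_mul_fderiv_eq_neg_fderiv_mul_of_integrable (μ := volume) (𝕜 := ℂ)
    (f := F) (g := fun w => (p w : ℂ)) (v := Pi.single k 1)
    (hF1.congr (.of_forall fun w => by simp [mul_comm]))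
    ((hF2.const_mul (-(v k : ℂ)⁻¹)).congr (.of_forall fun w => by
      simp only [hpc]; ring))
    (hF0.congr (.of_forall fun w => by simp [mul_comm]))
    (fun x _ => hF x) (fun x _ => (Complex.ofRealCLM.differentiableAt.comp x (hpd x)))
  simp only [hpc] at key
  have e1 : ∫ w, (p w : ℂ) * fderiv ℝ F w (Pi.single k 1) =
      ∫ w, fderiv ℝ F w (Pi.single k 1) * p w := by simp only [mul_comm]
  have e2 : ∫ w, (p w : ℂ) * (w k * F w) =
      -(v k : ℂ) * ∫ w, F w * (-((w k : ℂ) / v k) * p w) := by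
    rw [← integral_const_mul]
    congr 1; ext w; field_simp
  rw [e1, e2, key]; ring

/-- `HasMomentsUpTo μ m f`: `f` is smooth and its partial derivatives of order at most `m`
have moments of all orders. -/
def HasMomentsUpTo {ι : Type*} [Fintype ι] [DecidableEq ι] (μ : Measure (ι → ℝ)) :
    ℕ → ((ι → ℝ) → ℝ) → Prop
  | 0, f => ContDiff ℝ (⊤ : ℕ∞) f ∧ ∀ p : ENNReal, p ≠ ⊤ → MemLp f p μ
  | m + 1, f => (ContDiff ℝ (⊤ : ℕ∞) f ∧ ∀ p : ENNReal, p ≠ ⊤ → MemLp f p μ) ∧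
      ∀ k, HasMomentsUpTo μ m (fun w => fderiv ℝ f w (Pi.single k 1))

namespace HasMomentsUpTo

variable {ι : Type*} [Fintype ι] [DecidableEq ι] {μ : Measure (ι → ℝ)} {m : ℕ}
  {f g : (ι → ℝ) → ℝ}

theorem zero_order (hf : HasMomentsUpTo μ m f) : HasMomentsUpTo μ 0 f := by
  cases m with
  | zero => exact hf
  | succ m => exact hf.1

theorem contDiff (hf : HasMomentsUpTo μ m f) : ContDiff ℝ (⊤ : ℕ∞) f := hf.zero_order.1

theorem memLp (hf : HasMomentsUpTo μ m f) {p : ENNReal} (hp : p ≠ ⊤) : MemLp f p μ :=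
  hf.zero_order.2 p hp

theorem differentiable (hf : HasMomentsUpTo μ m f) : Differentiable ℝ f :=
  hf.contDiff.differentiable (by simp)

theorem integrable (hf : HasMomentsUpTo μ m f) : Integrable f μ :=
  memLp_one_iff_integrable.1 (hf.memLp ENNReal.one_ne_top)

theorem fderiv_single (hf : HasMomentsUpTo μ (m + 1) f) (k : ι) :
    HasMomentsUpTo μ m (fun w => fderiv ℝ f w (Pi.single k 1)) := hf.2 k

theorem of_succ (hf : HasMomentsUpTo μ (m + 1) f) : HasMomentsUpTo μ m f := by
  induction m generalizing f with
  | zero => exact hf.1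
  | succ m ih => exact ⟨hf.1, fun k => ih (hf.2 k)⟩

theorem const [IsFiniteMeasure μ] (c : ℝ) : HasMomentsUpTo μ m (fun _ => c) := by
  induction m generalizing c with
  | zero => exact ⟨contDiff_const, fun p _ => memLp_const c⟩
  | succ m ih =>
    exact ⟨⟨contDiff_const, fun p _ => memLp_const c⟩, fun k => by simpa using ih 0⟩

theorem add (hf : HasMomentsUpTo μ m f) (hg : HasMomentsUpTo μ m g) :
    HasMomentsUpTo μ m (fun w => f w + g w) := by
  have h0 {f g : (ι → ℝ) → ℝ} (hf : HasMomentsUpTo μ 0 f) (hg : HasMomentsUpTo μ 0 g) :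
      HasMomentsUpTo μ 0 (fun w => f w + g w) :=
    ⟨hf.1.add hg.1, fun p hp => (hf.2 p hp).add (hg.2 p hp)⟩
  induction m generalizing f g with
  | zero => exact h0 hf hg
  | succ m ih =>
    refine ⟨h0 hf.1 hg.1, fun k => ?_⟩
    have : (fun w => fderiv ℝ (fun w => f w + g w) w (Pi.single k 1)) =
        fun w => fderiv ℝ f w (Pi.single k 1) + fderiv ℝ g w (Pi.single k 1) := by
      ext w
      rw [fderiv_fun_add (hf.differentiable w) (hg.differentiable w)]; rfl
    rw [this]
    exact ih (hf.2 k) (hg.2 k)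

theorem mul (hf : HasMomentsUpTo μ m f) (hg : HasMomentsUpTo μ m g) :
    HasMomentsUpTo μ m (fun w => f w * g w) := by
  have h0 {f g : (ι → ℝ) → ℝ} (hf : HasMomentsUpTo μ 0 f) (hg : HasMomentsUpTo μ 0 g) :
      HasMomentsUpTo μ 0 (fun w => f w * g w) := by
    refine ⟨hf.1.mul hg.1, fun p hp => ?_⟩
    have hp2 : p * 2 ≠ ⊤ := ENNReal.mul_ne_top hp (by simp)
    have : ENNReal.HolderTriple (p * 2) (p * 2) p := ⟨by
      rw [ENNReal.mul_inv (by simp) (by simp), ← mul_add, ENNReal.inv_two_add_inv_two, mul_one]⟩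
    exact (hg.2 _ hp2).mul' (hf.2 _ hp2)
  induction m generalizing f g with
  | zero => exact h0 hf hg
  | succ m ih =>
    refine ⟨h0 hf.1 hg.1, fun k => ?_⟩
    have : (fun w => fderiv ℝ (fun w => f w * g w) w (Pi.single k 1)) =
        fun w => f w * fderiv ℝ g w (Pi.single k 1) + g w * fderiv ℝ f w (Pi.single k 1) := by
      ext w
      rw [fderiv_fun_mul (hf.differentiable w) (hg.differentiable w)]; rfl
    rw [this]
    exact (ih hf.of_succ (hg.2 k)).add (ih hg.of_succ (hf.2 k))

theorem sum [IsFiniteMeasure μ] {α : Type*} (s : Finset α) {F : α → (ι → ℝ) → ℝ}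
    (hF : ∀ a ∈ s, HasMomentsUpTo μ m (F a)) :
    HasMomentsUpTo μ m (fun w => ∑ a ∈ s, F a w) := by
  classical
  induction s using Finset.induction_on with
  | empty => simpa using const 0
  | insert a s ha ih =>
    simp only [Finset.sum_insert ha]
    exact (hF a (by simp)).add (ih fun b hb => hF b (by simp [hb]))

theorem prod [IsFiniteMeasure μ] {α : Type*} (s : Finset α) {F : α → (ι → ℝ) → ℝ}
    (hF : ∀ a ∈ s, HasMomentsUpTo μ m (F a)) :
    HasMomentsUpTo μ m (fun w => ∏ a ∈ s, F a w) := by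
  classical
  induction s using Finset.induction_on with
  | empty => simpa using const 1
  | insert a s ha ih =>
    simp only [Finset.prod_insert ha]
    exact (hF a (by simp)).mul (ih fun b hb => hF b (by simp [hb]))

theorem neg [IsFiniteMeasure μ] (hf : HasMomentsUpTo μ m f) :
    HasMomentsUpTo μ m (fun w => -f w) := by
  simpa using (const (-1)).mul hf

theorem sub [IsFiniteMeasure μ] (hf : HasMomentsUpTo μ m f) (hg : HasMomentsUpTo μ m g) :
    HasMomentsUpTo μ m (fun w => f w - g w) := by
  simpa [sub_eq_add_neg] using hf.add hg.neg

theorem det [IsFiniteMeasure μ] {α : Type*} [Fintype α] [DecidableEq α]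
    {A : (ι → ℝ) → Matrix α α ℝ} (hA : ∀ i j, HasMomentsUpTo μ m (fun w => A w i j)) :
    HasMomentsUpTo μ m (fun w => (A w).det) := by
  simp only [Matrix.det_apply']
  exact sum _ fun σ _ => (const _).mul (prod _ fun i _ => hA _ _)

theorem adjugate [IsFiniteMeasure μ] {α : Type*} [Fintype α] [DecidableEq α]
    {A : (ι → ℝ) → Matrix α α ℝ} (hA : ∀ i j, HasMomentsUpTo μ m (fun w => A w i j)) (i j : α) :
    HasMomentsUpTo μ m (fun w => (A w).adjugate i j) := by
  simp only [Matrix.adjugate_apply]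
  refine det fun a b => ?_
  by_cases h : a = j
  · subst h; simpa using const _
  · simpa [Matrix.updateRow_ne h] using hA a b

/-- If `f` has no zero and `f⁻¹` has moments of all orders, then so do the derivatives of
`f⁻¹`. -/
theorem inv [IsFiniteMeasure μ] (hf : HasMomentsUpTo μ m f) (hne : ∀ w, f w ≠ 0)
    (hinv : ∀ p : ENNReal, p ≠ ⊤ → MemLp (fun w => (f w)⁻¹) p μ) :
    HasMomentsUpTo μ m (fun w => (f w)⁻¹) := by
  have hc : ContDiff ℝ (⊤ : ℕ∞) (fun w => (f w)⁻¹) := hf.contDiff.inv hne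
  induction m with
  | zero => exact ⟨hc, hinv⟩
  | succ m ih =>
    refine ⟨⟨hc, hinv⟩, fun k => ?_⟩
    have : (fun w => fderiv ℝ (fun w => (f w)⁻¹) w (Pi.single k 1)) =
        fun w => -((f w)⁻¹ * (f w)⁻¹ * fderiv ℝ f w (Pi.single k 1)) := by
      ext w
      have hd := (hasDerivAt_inv (hne w)).comp_hasFDerivAt w (hf.differentiable w).hasFDerivAt
      rw [show (fun w => (f w)⁻¹) = (fun y => y⁻¹) ∘ f from rfl, hd.fderiv]
      simp [pow_two]
    rw [this]
    have h := ih hf.of_succ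
    exact ((h.mul h).mul (hf.2 k)).neg

theorem eval_pi_gaussianReal (v : ι → NNReal) (k : ι) :
    HasMomentsUpTo (Measure.pi fun k => gaussianReal 0 (v k)) m (fun w => w k) := by
  have h0 : HasMomentsUpTo (Measure.pi fun k => gaussianReal 0 (v k)) 0 (fun w => w k) :=
    ⟨contDiff_apply ℝ ℝ k, fun p hp =>
      (memLp_id_gaussianReal' p hp).comp_measurePreserving
        (measurePreserving_eval (fun k => gaussianReal 0 (v k)) k)⟩
  cases m with
  | zero => exact h0
  | succ m =>
    refine ⟨h0, fun j => ?_⟩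
    have : (fun w => fderiv ℝ (fun w : ι → ℝ => w k) w (Pi.single j 1)) =
        fun _ => (Pi.single j 1 : ι → ℝ) k := by
      ext w
      rw [(hasFDerivAt_apply k w).fderiv]; rfl
    rw [this]
    exact const _

omit [Fintype ι] [DecidableEq ι] in
theorem memLp_of_integrable_rpow [IsFiniteMeasure μ] (hf : AEStronglyMeasurable f μ)
    (h : ∀ p : ℝ, 1 < p → Integrable (fun w => |f w| ^ p) μ) {p : ENNReal} (hp : p ≠ ⊤) :
    MemLp f p μ := by
  have h1 : 1 < p.toReal + 2 := by linarith [p.toReal_nonneg]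
  have h2 : MemLp f (ENNReal.ofReal (p.toReal + 2)) μ := by
    rw [← integrable_norm_rpow_iff hf (by simp; linarith) (by simp),
      ENNReal.toReal_ofReal (by linarith)]
    exact h _ h1
  refine h2.mono_exponent ?_
  rw [← ENNReal.ofReal_toReal hp]
  exact ENNReal.ofReal_le_ofReal (by simp)

theorem of_integrable_iteratedFDeriv [IsFiniteMeasure μ] (hf : ContDiff ℝ (⊤ : ℕ∞) f)
    (h : ∀ p : ℝ, 1 < p → ∀ (r : ℕ) (ks : Fin r → ι),
      Integrable (fun w => |iteratedFDeriv ℝ r f w (fun j => Pi.single (ks j) 1)| ^ p) μ) :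
    HasMomentsUpTo μ m f := by
  have hcf (r : ℕ) : ContDiff ℝ (⊤ : ℕ∞) (iteratedFDeriv ℝ r f) :=
    hf.iteratedFDeriv_right (by norm_cast)
  have hc (r : ℕ) (ks : Fin r → ι) : ContDiff ℝ (⊤ : ℕ∞)
      (fun w => iteratedFDeriv ℝ r f w (fun j => Pi.single (ks j) 1)) :=
    (ContinuousMultilinearMap.apply ℝ (fun _ : Fin r => ι → ℝ) ℝ
      (fun j => Pi.single (ks j) 1)).contDiff.comp (hcf r)
  have h0 (r : ℕ) (ks : Fin r → ι) : HasMomentsUpTo μ 0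
      (fun w => iteratedFDeriv ℝ r f w (fun j => Pi.single (ks j) 1)) :=
    ⟨hc r ks, fun p hp => memLp_of_integrable_rpow
      (hc r ks).continuous.aestronglyMeasurable (fun p hp => h p hp r ks) hp⟩
  have key (r : ℕ) (ks : Fin r → ι) : HasMomentsUpTo μ m
      (fun w => iteratedFDeriv ℝ r f w (fun j => Pi.single (ks j) 1)) := by
    induction m generalizing r ks with
    | zero => exact h0 r ks
    | succ m ih =>
      refine ⟨h0 r ks, fun k => ?_⟩
      have : (fun w => fderiv ℝ (fun w => iteratedFDeriv ℝ r f w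
          (fun j => Pi.single (ks j) 1)) w (Pi.single k 1)) =
          fun w => iteratedFDeriv ℝ (r + 1) f w
            (fun j => Pi.single ((Fin.cons k ks : Fin (r + 1) → ι) j) 1) := by
        ext w
        rw [iteratedFDeriv_succ_apply_left]
        have hd := ((ContinuousMultilinearMap.apply ℝ (fun _ : Fin r => ι → ℝ) ℝ
          (fun j => Pi.single (ks j) 1)).hasFDerivAt (x := iteratedFDeriv ℝ r f w)).comp w
          (((hcf r).differentiable (by simp)) w).hasFDerivAt
        have e : (fun w => iteratedFDeriv ℝ r f w (fun j => Pi.single (ks j) 1)) =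
          (ContinuousMultilinearMap.apply ℝ (fun _ : Fin r => ι → ℝ) ℝ
          (fun j => Pi.single (ks j) 1)) ∘ iteratedFDeriv ℝ r f := rfl
        rw [e, hd.fderiv]
        simp [Fin.tail_def]
      rw [this]
      exact ih _ _
  simpa using key 0 Fin.elim0

end HasMomentsUpTo

/-- The plane wave `exp (i ⟨ξ, Y⟩)` of frequency `ξ` along `Y`. -/
noncomputable def planeWave {Ω α : Type*} [Fintype α] (Y : α → Ω → ℝ) (ξ : α → ℝ) (w : Ω) :
    ℂ :=
  Complex.exp ((∑ j, ξ j * Y j w : ℝ) * Complex.I)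

section PlaneWave

variable {ι α : Type*} [Fintype ι] [DecidableEq ι] [Fintype α]
  {Y : α → (ι → ℝ) → ℝ}

theorem norm_planeWave {Ω : Type*} (Y : α → Ω → ℝ) (ξ : α → ℝ) (w : Ω) :
    ‖planeWave Y ξ w‖ = 1 :=
  Complex.norm_exp_ofReal_mul_I _

omit [DecidableEq ι] in
theorem integrable_planeWave_mul {μ : Measure (ι → ℝ)} (hY : ∀ j, Continuous (Y j)) (ξ : α → ℝ)
    {g : (ι → ℝ) → ℂ} (hg : Integrable g μ) :
    Integrable (fun w => planeWave Y ξ w * g w) μ := by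
  refine hg.bdd_mul (c := 1) ?_ (.of_forall fun w => (norm_planeWave Y ξ w).le)
  unfold planeWave
  exact Continuous.aestronglyMeasurable (by fun_prop)

omit [DecidableEq ι] in
theorem hasFDerivAt_planeWave (hY : ∀ j, Differentiable ℝ (Y j)) (ξ : α → ℝ) (w : ι → ℝ) :
    HasFDerivAt (planeWave Y ξ) (planeWave Y ξ w •
      (Complex.I • Complex.ofRealCLM.comp (∑ j, ξ j • fderiv ℝ (Y j) w))) w := by
  have h1 : HasFDerivAt (fun w => ∑ j, ξ j * Y j w) (∑ j, ξ j • fderiv ℝ (Y j) w) w :=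
    HasFDerivAt.fun_sum fun j _ => (hY j w).hasFDerivAt.const_mul (ξ j)
  have h2 := (Complex.ofRealCLM.hasFDerivAt.comp w h1).mul_const Complex.I
  exact h2.cexp

/-- Gaussian integration by parts against a plane wave. -/
theorem integral_planeWave_mul_divergence (v : ι → NNReal) (hv : ∀ k, v k ≠ 0)
    (hY : ∀ j m, HasMomentsUpTo (Measure.pi fun k => gaussianReal 0 (v k)) m (Y j))
    {g : (ι → ℝ) → ℝ}
    (hg : ∀ m, HasMomentsUpTo (Measure.pi fun k => gaussianReal 0 (v k)) m g) (k : ι) (ξ : α → ℝ) :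
    ∫ w, planeWave Y ξ w * ((w k * g w - v k * fderiv ℝ g w (Pi.single k 1) : ℝ) : ℂ)
        ∂(Measure.pi fun k => gaussianReal 0 (v k)) =
      ∫ w, planeWave Y ξ w * (Complex.I * ((∑ l, ξ l * (v k * fderiv ℝ (Y l) w (Pi.single k 1) *
        g w) : ℝ) : ℂ)) ∂(Measure.pi fun k => gaussianReal 0 (v k)) := by
  set μ := Measure.pi fun k => gaussianReal 0 (v k) with hμ
  have hYc (j : α) : Continuous (Y j) := (hY j 0).contDiff.continuous
  have hYd (j : α) : Differentiable ℝ (Y j) := (hY j 0).differentiable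
  have hint {f : (ι → ℝ) → ℝ} (hf : HasMomentsUpTo μ 0 f) :
      Integrable (fun w => planeWave Y ξ w * (f w : ℂ)) μ :=
    integrable_planeWave_mul hYc ξ hf.integrable.ofReal
  have hg1 : HasMomentsUpTo μ 0 (fun w => fderiv ℝ g w (Pi.single k 1)) := (hg 1).fderiv_single k
  have hwg : HasMomentsUpTo μ 0 (fun w => w k * g w) :=
    (HasMomentsUpTo.eval_pi_gaussianReal v k).mul (hg 0)
  have hS : HasMomentsUpTo μ 0
      (fun w => ∑ l, ξ l * (v k * fderiv ℝ (Y l) w (Pi.single k 1) * g w)) :=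
    .sum _ fun l _ => (HasMomentsUpTo.const _).mul
      (((HasMomentsUpTo.const _).mul ((hY l 1).fderiv_single k)).mul (hg 0))
  have hS' : HasMomentsUpTo μ 0
      (fun w => (∑ l, ξ l * fderiv ℝ (Y l) w (Pi.single k 1)) * g w) :=
    (HasMomentsUpTo.sum _ fun l _ => (HasMomentsUpTo.const _).mul
      ((hY l 1).fderiv_single k)).mul (hg 0)
  have hF (w : ι → ℝ) := (hasFDerivAt_planeWave hYd ξ w).mul
    (Complex.ofRealCLM.hasFDerivAt.comp w ((hg 0).differentiable w).hasFDerivAt)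
  have hF' (w : ι → ℝ) : fderiv ℝ (fun w => planeWave Y ξ w * (g w : ℂ)) w (Pi.single k 1) =
      planeWave Y ξ w * (fderiv ℝ g w (Pi.single k 1) : ℝ) +
      planeWave Y ξ w * ((((∑ l, ξ l * fderiv ℝ (Y l) w (Pi.single k 1)) * g w : ℝ) : ℂ)) *
        Complex.I := by
    have := (hF w).fderiv
    rw [show (fun w => planeWave Y ξ w * (g w : ℂ)) =
      planeWave Y ξ * (Complex.ofRealCLM ∘ g) from rfl, this]
    simp
    ring
  have key := integral_fderiv_single_pi_gaussianReal v hv k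
    (F := fun w => planeWave Y ξ w * (g w : ℂ)) (fun w => (hF w).differentiableAt) (hint (hg 0))
    (by simp only [hF']; exact (hint hg1).add ((hint hS').mul_const _))
    ((hint hwg).congr (.of_forall fun w => by simp only; push_cast; ring))
  simp only [hF'] at key
  rw [integral_add (hint hg1) ((hint hS').mul_const _), mul_add, ← hμ] at key
  have e1 : ∫ w, planeWave Y ξ w * ((w k * g w - v k * fderiv ℝ g w (Pi.single k 1) : ℝ) : ℂ) ∂μ =
      ∫ w, (w k : ℂ) * (planeWave Y ξ w * g w) ∂μ -
        v k * ∫ w, planeWave Y ξ w * (fderiv ℝ g w (Pi.single k 1) : ℝ) ∂μ := by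
    rw [← integral_const_mul, ← integral_sub]
    · congr 1; ext w; push_cast; ring
    · exact (hint hwg).congr (.of_forall fun w => by simp only; push_cast; ring)
    · exact (hint hg1).const_mul _
  rw [e1, ← key, add_sub_cancel_left, ← integral_const_mul]
  congr 1; ext w
  push_cast
  simp only [Finset.sum_mul, Finset.mul_sum]
  exact Finset.sum_congr rfl fun l _ => by ring

/-- Each frequency can be absorbed into the amplitude when the Malliavin matrix has an inverse `B`
all of whose derivatives have moments of all orders. -/
theorem exists_freq_mul_integral_planeWave_eq [DecidableEq α] (v : ι → NNReal)
    (hv : ∀ k, v k ≠ 0)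
    (hY : ∀ j m, HasMomentsUpTo (Measure.pi fun k => gaussianReal 0 (v k)) m (Y j))
    {B : (ι → ℝ) → Matrix α α ℝ}
    (hB : ∀ i j m, HasMomentsUpTo (Measure.pi fun k => gaussianReal 0 (v k)) m (fun w => B w i j))
    (hBM : ∀ w, B w * Matrix.of (fun i j => ∑ k, fderiv ℝ (Y i) w (Pi.single k 1) *
      fderiv ℝ (Y j) w (Pi.single k 1) * v k) = 1)
    {g : (ι → ℝ) → ℝ}
    (hg : ∀ m, HasMomentsUpTo (Measure.pi fun k => gaussianReal 0 (v k)) m g) (j : α) :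
    ∃ h : (ι → ℝ) → ℝ,
      (∀ m, HasMomentsUpTo (Measure.pi fun k => gaussianReal 0 (v k)) m h) ∧
      ∀ ξ : α → ℝ, Complex.I * ξ j *
        ∫ w, planeWave Y ξ w * (g w : ℂ) ∂(Measure.pi fun k => gaussianReal 0 (v k)) =
        ∫ w, planeWave Y ξ w * (h w : ℂ) ∂(Measure.pi fun k => gaussianReal 0 (v k)) := by
  set μ := Measure.pi fun k => gaussianReal 0 (v k) with hμ
  have hYc (j : α) : Continuous (Y j) := (hY j 0).contDiff.continuous
  have hint {f : (ι → ℝ) → ℝ} (hf : HasMomentsUpTo μ 0 f) (ξ : α → ℝ) :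
      Integrable (fun w => planeWave Y ξ w * (f w : ℂ)) μ :=
    integrable_planeWave_mul hYc ξ hf.integrable.ofReal
  let G (i : α) (k : ι) (w : ι → ℝ) : ℝ := B w j i * fderiv ℝ (Y i) w (Pi.single k 1) * g w
  have hG (i : α) (k : ι) (m : ℕ) : HasMomentsUpTo μ m (G i k) :=
    ((hB j i m).mul ((hY i (m + 1)).fderiv_single k)).mul (hg m)
  let D (i : α) (k : ι) (w : ι → ℝ) : ℝ :=
    w k * G i k w - v k * fderiv ℝ (G i k) w (Pi.single k 1)
  have hD (i : α) (k : ι) (m : ℕ) : HasMomentsUpTo μ m (D i k) :=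
    ((HasMomentsUpTo.eval_pi_gaussianReal v k).mul (hG i k m)).sub
      ((HasMomentsUpTo.const _).mul ((hG i k (m + 1)).fderiv_single k))
  refine ⟨fun w => ∑ i, ∑ k, D i k w, fun m => .sum _ fun i _ => .sum _ fun k _ => hD i k m,
    fun ξ => ?_⟩
  have hsum : ∫ w, planeWave Y ξ w * ((∑ i, ∑ k, D i k w : ℝ) : ℂ) ∂μ =
      ∑ i, ∑ k, ∫ w, planeWave Y ξ w * (D i k w : ℂ) ∂μ := by
    push_cast
    simp only [Finset.mul_sum]
    rw [integral_finsetSum _ fun i _ => integrable_finsetSum _ fun k _ => hint (hD i k 0) ξ]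
    exact Finset.sum_congr rfl fun i _ => integral_finsetSum _ fun k _ => hint (hD i k 0) ξ
  have hS (i : α) (k : ι) : HasMomentsUpTo μ 0
      (fun w => ∑ l, ξ l * (v k * fderiv ℝ (Y l) w (Pi.single k 1) * G i k w)) :=
    .sum _ fun l _ => (HasMomentsUpTo.const _).mul
      (((HasMomentsUpTo.const _).mul ((hY l 1).fderiv_single k)).mul (hG i k 0))
  have hintS (i : α) (k : ι) : Integrable (fun w => planeWave Y ξ w * (Complex.I *
      ((∑ l, ξ l * (v k * fderiv ℝ (Y l) w (Pi.single k 1) * G i k w) : ℝ) : ℂ))) μ :=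
    ((hint (hS i k) ξ).const_mul Complex.I).congr (.of_forall fun w => by ring)
  rw [hsum]
  simp only [D]
  rw [Finset.sum_congr rfl fun i _ => Finset.sum_congr rfl fun k _ =>
    integral_planeWave_mul_divergence v hv hY (hG i k) k ξ, ← hμ,
    Finset.sum_congr rfl fun i _ => (integral_finsetSum _ fun k _ => hintS i k).symm,
    ← integral_finsetSum _ fun i _ => integrable_finsetSum _ fun k _ => hintS i k,
    ← integral_const_mul]
  congr 1; ext w
  have hreal : ∑ i, ∑ k, ∑ l, ξ l * (v k * fderiv ℝ (Y l) w (Pi.single k 1) * G i k w) =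
      ξ j * g w := by
    have h1 (l : α) : ∑ i, B w j i * ∑ k, fderiv ℝ (Y i) w (Pi.single k 1) *
        fderiv ℝ (Y l) w (Pi.single k 1) * v k = (1 : Matrix α α ℝ) j l := by
      rw [← hBM w, Matrix.mul_apply]; rfl
    calc ∑ i, ∑ k, ∑ l, ξ l * (v k * fderiv ℝ (Y l) w (Pi.single k 1) * G i k w)
        = ∑ l, ξ l * g w * ∑ i, B w j i * ∑ k, fderiv ℝ (Y i) w (Pi.single k 1) *
          fderiv ℝ (Y l) w (Pi.single k 1) * v k := by
          simp only [Finset.mul_sum, G]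
          rw [Finset.sum_congr rfl fun i _ => Finset.sum_comm, Finset.sum_comm]
          refine Finset.sum_congr rfl fun l _ => Finset.sum_congr rfl fun i _ =>
            Finset.sum_congr rfl fun k _ => by ring
      _ = ξ j * g w := by simp [h1, Matrix.one_apply]
  simp only [← Finset.mul_sum]
  rw [← mul_assoc] at *
  have := congrArg (fun x : ℝ => (x : ℂ)) hreal
  push_cast at this ⊢
  rw [this]; ring

theorem exists_japanese_pow_mul_integral_planeWave_eq [DecidableEq α] (v : ι → NNReal)
    (hv : ∀ k, v k ≠ 0)
    (hY : ∀ j m, HasMomentsUpTo (Measure.pi fun k => gaussianReal 0 (v k)) m (Y j))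
    {B : (ι → ℝ) → Matrix α α ℝ}
    (hB : ∀ i j m, HasMomentsUpTo (Measure.pi fun k => gaussianReal 0 (v k)) m (fun w => B w i j))
    (hBM : ∀ w, B w * Matrix.of (fun i j => ∑ k, fderiv ℝ (Y i) w (Pi.single k 1) *
      fderiv ℝ (Y j) w (Pi.single k 1) * v k) = 1) (r : ℕ) :
    ∃ h : (ι → ℝ) → ℝ,
      (∀ m, HasMomentsUpTo (Measure.pi fun k => gaussianReal 0 (v k)) m h) ∧
      ∀ ξ : α → ℝ, (((1 + ∑ j, ξ j ^ 2) ^ r : ℝ) : ℂ) *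
        ∫ w, planeWave Y ξ w ∂(Measure.pi fun k => gaussianReal 0 (v k)) =
        ∫ w, planeWave Y ξ w * (h w : ℂ) ∂(Measure.pi fun k => gaussianReal 0 (v k)) := by
  induction r with
  | zero => exact ⟨fun _ => 1, fun m => .const 1, by simp⟩
  | succ r ih =>
    obtain ⟨g, hg, hgeq⟩ := ih
    choose a ha haeq using exists_freq_mul_integral_planeWave_eq v hv hY hB hBM hg
    choose b hb hbeq using fun j =>
      exists_freq_mul_integral_planeWave_eq v hv hY hB hBM (ha j) j
    have hYc (j : α) : Continuous (Y j) := (hY j 0).contDiff.continuous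
    refine ⟨fun w => g w - ∑ j, b j w, fun m => (hg m).sub (.sum _ fun j _ => hb j m),
      fun ξ => ?_⟩
    have hintg : Integrable (fun w => planeWave Y ξ w * (g w : ℂ))
        (Measure.pi fun k => gaussianReal 0 (v k)) :=
      integrable_planeWave_mul hYc ξ (hg 0).integrable.ofReal
    have hintb (j : α) : Integrable (fun w => planeWave Y ξ w * (b j w : ℂ))
        (Measure.pi fun k => gaussianReal 0 (v k)) :=
      integrable_planeWave_mul hYc ξ (hb j 0).integrable.ofReal
    push_cast
    simp only [mul_sub, Finset.mul_sum]
    rw [integral_sub hintg (integrable_finsetSum _ fun j _ => hintb j),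
      integral_finsetSum _ fun j _ => hintb j]
    have hbb (j : α) := (hbeq j ξ).symm.trans (congrArg _ (haeq j ξ).symm)
    simp only [hbb, ← hgeq]
    push_cast
    have hI (j : α) (z : ℂ) : Complex.I * ξ j * (Complex.I * ξ j * z) = -((ξ j : ℂ) ^ 2 * z) := by
      linear_combination (ξ j : ℂ) ^ 2 * z * Complex.I_sq
    simp only [hI, Finset.sum_neg_distrib, ← Finset.sum_mul]
    ring

/-- Rapid decay of the characteristic function. -/
theorem exists_bound_integral_planeWave [DecidableEq α] (v : ι → NNReal)
    (hv : ∀ k, v k ≠ 0)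
    (hY : ∀ j m, HasMomentsUpTo (Measure.pi fun k => gaussianReal 0 (v k)) m (Y j))
    {B : (ι → ℝ) → Matrix α α ℝ}
    (hB : ∀ i j m, HasMomentsUpTo (Measure.pi fun k => gaussianReal 0 (v k)) m (fun w => B w i j))
    (hBM : ∀ w, B w * Matrix.of (fun i j => ∑ k, fderiv ℝ (Y i) w (Pi.single k 1) *
      fderiv ℝ (Y j) w (Pi.single k 1) * v k) = 1) (r : ℕ) :
    ∃ C : ℝ, ∀ ξ : α → ℝ, (1 + ∑ j, ξ j ^ 2) ^ r *
      ‖∫ w, planeWave Y ξ w ∂(Measure.pi fun k => gaussianReal 0 (v k))‖ ≤ C := by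
  obtain ⟨h, -, hheq⟩ := exists_japanese_pow_mul_integral_planeWave_eq v hv hY hB hBM r
  refine ⟨∫ w, |h w| ∂(Measure.pi fun k => gaussianReal 0 (v k)), fun ξ => ?_⟩
  have h0 : 0 ≤ (1 + ∑ j, ξ j ^ 2) ^ r := by positivity
  calc _ = ‖(((1 + ∑ j, ξ j ^ 2) ^ r : ℝ) : ℂ) *
        ∫ w, planeWave Y ξ w ∂(Measure.pi fun k => gaussianReal 0 (v k))‖ := by
          rw [norm_mul, Complex.norm_real, Real.norm_of_nonneg h0]
    _ ≤ _ := by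
      rw [hheq]
      refine (norm_integral_le_integral_norm _).trans_eq ?_
      simp [norm_planeWave]

end PlaneWave

section SmoothDensity

open scoped FourierTransform RealInnerProductSpace Real

variable {V : Type*} [NormedAddCommGroup V] [InnerProductSpace ℝ V] [FiniteDimensional ℝ V]
  [MeasurableSpace V] [BorelSpace V]

theorem integral_schwartz_eq_integral_fourier_mul_charFun (ν : Measure V) [IsFiniteMeasure ν]
    (f : SchwartzMap V ℂ) :
    ∫ x, f x ∂ν = ∫ ξ, 𝓕 f ξ * charFun ν ((2 * π) • ξ) := by
  have h := VectorFourier.integral_fourierIntegral_smul_eq_flip (μ := (volume : Measure V)) (ν := ν)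
    (L := -innerₗ V) (f := (𝓕 f : SchwartzMap V ℂ)) (g := fun _ => (1 : ℂ))
    Real.continuous_fourierChar continuous_inner.neg (𝓕 f).integrable (integrable_const _)
  have e1 (x : V) : VectorFourier.fourierIntegral 𝐞 volume (-innerₗ V)
      (𝓕 f : SchwartzMap V ℂ) x = f x := by
    calc _ = 𝓕⁻ (𝓕 f : SchwartzMap V ℂ) x := by
          rw [SchwartzMap.fourierInv_coe]; rfl
      _ = f x := by rw [FourierTransform.fourierInv_fourier_eq]
  have e2 (ξ : V) : VectorFourier.fourierIntegral 𝐞 ν (-innerₗ V).flip (fun _ => (1 : ℂ)) ξ =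
      charFun ν ((2 * π) • ξ) := by
    rw [charFun_apply, VectorFourier.fourierIntegral]
    congr 1; ext x
    simp [Circle.smul_def, Real.fourierChar_apply, inner_smul_right, real_inner_comm]
  simpa only [e1, e2, smul_eq_mul, mul_one] using h

theorem integral_fourier_mul_eq_of_integrable (f : SchwartzMap V ℂ) {φ : V → ℂ}
    (hφ : Integrable φ) : ∫ ξ, 𝓕 f ξ * φ ξ = ∫ x, f x * 𝓕 φ x := by
  have h := VectorFourier.integral_fourierIntegral_smul_eq_flip (μ := (volume : Measure V))
    (ν := (volume : Measure V)) (L := innerₗ V) (f := f) (g := φ)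
    Real.continuous_fourierChar continuous_inner f.integrable hφ
  rw [flip_innerₗ] at h
  exact h

theorem integrable_norm_pow_mul_of_japanese_bound {φ : V → ℂ} (hφ : AEStronglyMeasurable φ)
    (hdec : ∀ r : ℕ, ∃ C : ℝ, ∀ ξ, (1 + ‖ξ‖ ^ 2) ^ r * ‖φ ξ‖ ≤ C) (m : ℕ) :
    Integrable (fun ξ => ‖ξ‖ ^ m * ‖φ ξ‖) := by
  set d := Module.finrank ℝ V with hd
  obtain ⟨C, hC⟩ := hdec (m + (d + 1))
  have hint := (integrable_rpow_neg_one_add_norm_sq (E := V) (μ := volume) (r := 2 * (d + 1))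
    (by rw [← hd]; linarith [(Nat.cast_nonneg d : (0 : ℝ) ≤ d)])).const_mul C
  refine hint.mono' (by fun_prop) (.of_forall fun ξ => ?_)
  have h1 : 0 < 1 + ‖ξ‖ ^ 2 := by positivity
  have h2 : ‖ξ‖ ^ m ≤ (1 + ‖ξ‖ ^ 2) ^ m :=
    pow_le_pow_left₀ (norm_nonneg _) (by nlinarith [sq_nonneg (‖ξ‖ - 1), norm_nonneg ξ]) m
  have h3 : (1 + ‖ξ‖ ^ 2) ^ (-(2 * ((d : ℝ) + 1)) / 2) = ((1 + ‖ξ‖ ^ 2) ^ (d + 1))⁻¹ := by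
    rw [show -(2 * ((d : ℝ) + 1)) / 2 = -((d + 1 : ℕ) : ℝ) by push_cast; ring,
      Real.rpow_neg h1.le, Real.rpow_natCast]
  rw [h3, Real.norm_of_nonneg (by positivity), ← div_eq_mul_inv, le_div_iff₀ (by positivity)]
  calc ‖ξ‖ ^ m * ‖φ ξ‖ * (1 + ‖ξ‖ ^ 2) ^ (d + 1)
      ≤ (1 + ‖ξ‖ ^ 2) ^ m * ‖φ ξ‖ * (1 + ‖ξ‖ ^ 2) ^ (d + 1) := by gcongr
    _ = (1 + ‖ξ‖ ^ 2) ^ (m + (d + 1)) * ‖φ ξ‖ := by ring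
    _ ≤ C := hC ξ

theorem integral_eq_integral_mul_of_contDiff {ν : Measure V} [IsFiniteMeasure ν] {ρ : V → ℝ}
    (hρ : Continuous ρ)
    (h : ∀ g : V → ℝ, ContDiff ℝ (⊤ : ℕ∞) g → HasCompactSupport g →
      ∫ x, g x ∂ν = ∫ x, g x * ρ x)
    {f : V → ℝ} (hf : Continuous f) (hfs : HasCompactSupport f) :
    ∫ x, f x ∂ν = ∫ x, f x * ρ x := by
  choose g hgc hgd hgs using fun n : ℕ => hf.exists_contDiff_approx (⊤ : ℕ∞)
    (ε := fun _ => 1 / ((n : ℝ) + 1)) continuous_const (fun _ => by positivity)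
  have hgsupp (n : ℕ) : HasCompactSupport (g n) := hfs.mono (hgs n)
  have hlim (x : V) : Filter.Tendsto (fun n => g n x) Filter.atTop (nhds (f x)) :=
    tendsto_iff_dist_tendsto_zero.2 <| squeeze_zero (fun _ => dist_nonneg)
      (fun n => (hgd n x).le) tendsto_one_div_add_atTop_nhds_zero_nat
  have hle (n : ℕ) (x : V) : ‖g n x‖ ≤ ‖f x‖ + 1 := by
    have h1 := (hgd n x).le
    have h2 : 1 / ((n : ℝ) + 1) ≤ 1 := by
      rw [div_le_one (by positivity)]; linarith [(Nat.cast_nonneg n : (0 : ℝ) ≤ n)]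
    rw [dist_eq_norm] at h1
    linarith [norm_le_norm_add_norm_sub' (g n x) (f x)]
  have l1 : Filter.Tendsto (fun n => ∫ x, g n x ∂ν) Filter.atTop (nhds (∫ x, f x ∂ν)) := by
    refine tendsto_integral_of_dominated_convergence (fun x => ‖f x‖ + 1)
      (fun n => (hgc n).continuous.aestronglyMeasurable)
      ((hf.integrable_of_hasCompactSupport hfs).norm.add (integrable_const _))
      (fun n => .of_forall (hle n)) (.of_forall hlim)
  have l2 : Filter.Tendsto (fun n => ∫ x, g n x * ρ x) Filter.atTop
      (nhds (∫ x, f x * ρ x)) := by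
    refine tendsto_integral_of_dominated_convergence
      (fun x => (tsupport f).indicator (fun x => (‖f x‖ + 1) * ‖ρ x‖) x)
      (fun n => ((hgc n).continuous.mul hρ).aestronglyMeasurable) ?_
      (fun n => .of_forall fun x => ?_) (.of_forall fun x => (hlim x).mul_const _)
    · rw [integrable_indicator_iff (isClosed_tsupport f).measurableSet]
      exact Continuous.continuousOn (by fun_prop) |>.integrableOn_compact hfs
    · by_cases hx : x ∈ tsupport f
      · rw [Set.indicator_of_mem hx, norm_mul]
        gcongr
        exact hle n x
      · have : g n x = 0 := by
          by_contra hne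
          exact hx (subset_tsupport f (hgs n hne))
        simp [this, hx]
  refine tendsto_nhds_unique l1 ?_
  simpa only [h _ (hgc _) (hgsupp _)] using l2

theorem nonneg_of_integral_mul_nonneg {ρ : V → ℝ} (hρ : Continuous ρ)
    (h : ∀ f : V → ℝ, Continuous f → HasCompactSupport f → (∀ x, 0 ≤ f x) →
      0 ≤ ∫ x, f x * ρ x) (x : V) : 0 ≤ ρ x := by
  by_contra! hx
  obtain ⟨ε, hε, hball⟩ :=
    Metric.eventually_nhds_iff_ball.1 (hρ.continuousAt.eventually_lt_const hx)
  let b : ContDiffBump x := ⟨ε / 2, ε, by positivity, by linarith⟩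
  have hb := h b b.continuous b.hasCompactSupport fun _ => b.nonneg
  have hle (y : V) : b y * ρ y ≤ 0 := by
    by_cases hy : y ∈ Metric.ball x ε
    · exact mul_nonpos_of_nonneg_of_nonpos b.nonneg (hball y hy).le
    · rw [b.zero_of_le_dist (by simpa using hy), zero_mul]
  have hpos : 0 < ∫ y, -(b y * ρ y) := by
    refine Continuous.integral_pos_of_hasCompactSupport_nonneg_nonzero (x := x)
      (b.continuous.mul hρ).neg (b.hasCompactSupport.mul_right.neg)
      (fun y => by simpa using hle y) ?_
    rw [b.one_of_mem_closedBall (Metric.mem_closedBall_self b.rIn_pos.le)]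
    simpa using hx.ne
  rw [integral_neg] at hpos
  linarith

/-- A finite measure whose characteristic function decays rapidly has a smooth density. -/
theorem exists_contDiff_density_of_charFun_decay (ν : Measure V) [IsFiniteMeasure ν]
    (hdec : ∀ r : ℕ, ∃ C : ℝ, ∀ ξ, (1 + ‖ξ‖ ^ 2) ^ r * ‖charFun ν ξ‖ ≤ C) :
    ∃ ρ : V → ℝ, ContDiff ℝ (⊤ : ℕ∞) ρ ∧ (∀ x, 0 ≤ ρ x) ∧
      ν = volume.withDensity (fun x => ENNReal.ofReal (ρ x)) := by
  set φ : V → ℂ := fun ξ => charFun ν ((2 * π) • ξ) with hφ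
  have hφm : StronglyMeasurable φ :=
    (measurable_charFun.comp (measurable_const_smul (2 * π))).stronglyMeasurable
  have hφdec (r : ℕ) : ∃ C : ℝ, ∀ ξ, (1 + ‖ξ‖ ^ 2) ^ r * ‖φ ξ‖ ≤ C := by
    obtain ⟨C, hC⟩ := hdec r
    refine ⟨C, fun ξ => le_trans ?_ (hC ((2 * π) • ξ))⟩
    have : ‖ξ‖ ≤ ‖(2 * π) • ξ‖ := by
      rw [norm_smul, Real.norm_of_nonneg Real.two_pi_pos.le]
      exact le_mul_of_one_le_left (norm_nonneg _) (by linarith [Real.pi_gt_three])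
    gcongr
  have hφint (m : ℕ) := integrable_norm_pow_mul_of_japanese_bound
    hφm.aestronglyMeasurable hφdec m
  have hφ0 : Integrable φ :=
    (integrable_norm_iff hφm.aestronglyMeasurable).1 (by simpa using hφint 0)
  have hFc : ContDiff ℝ (⊤ : ℕ∞) (𝓕 φ) := Real.contDiff_fourier fun m _ => hφint m
  set ρ : V → ℝ := fun x => (𝓕 φ x).re with hρ
  have hρc : ContDiff ℝ (⊤ : ℕ∞) ρ := Complex.reCLM.contDiff.comp hFc
  have hsmooth (g : V → ℝ) (hg : ContDiff ℝ (⊤ : ℕ∞) g) (hgs : HasCompactSupport g) :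
      ∫ x, g x ∂ν = ∫ x, g x * ρ x := by
    have hg1 : HasCompactSupport (Complex.ofRealCLM ∘ g) := hgs.comp_left rfl
    have hg2 : ContDiff ℝ (⊤ : ℕ∞) (Complex.ofRealCLM ∘ g) := Complex.ofRealCLM.contDiff.comp hg
    have key := (integral_schwartz_eq_integral_fourier_mul_charFun ν (hg1.toSchwartzMap hg2)).trans
      (integral_fourier_mul_eq_of_integrable (hg1.toSchwartzMap hg2) hφ0)
    simp only [HasCompactSupport.toSchwartzMap_toFun, Function.comp_apply,
      Complex.ofRealCLM_apply] at key
    have hgi : Integrable (fun x => (g x : ℂ) * 𝓕 φ x) :=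
      Continuous.integrable_of_hasCompactSupport
        ((Complex.continuous_ofReal.comp hg.continuous).mul hFc.continuous) hg1.mul_right
    have hre := congrArg Complex.re key
    rw [integral_complex_ofReal, Complex.ofReal_re] at hre
    rw [hre]
    refine (integral_re hgi).symm.trans ?_
    simp [hρ]
  have hcont {f : V → ℝ} (hf : Continuous f) (hfs : HasCompactSupport f) :=
    integral_eq_integral_mul_of_contDiff hρc.continuous hsmooth hf hfs
  have hρ0 : ∀ x, 0 ≤ ρ x := nonneg_of_integral_mul_nonneg hρc.continuous fun f hf hfs hf0 =>
    hcont hf hfs ▸ integral_nonneg hf0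
  refine ⟨ρ, hρc, hρ0, ?_⟩
  have : IsLocallyFiniteMeasure (volume.withDensity fun x => ENNReal.ofReal (ρ x)) :=
    IsLocallyFiniteMeasure.withDensity_ofReal hρc.continuous
  refine Measure.ext_of_integral_eq_on_compactlySupported fun f => ?_
  refine (hcont f.continuous f.hasCompactSupport).trans ?_
  rw [integral_withDensity_eq_integral_toReal_smul hρc.continuous.measurable.ennreal_ofReal
      (.of_forall fun _ => ENNReal.ofReal_lt_top)]
  simp [ENNReal.toReal_ofReal (hρ0 _), mul_comm]

end SmoothDensity

theorem Matrix.abs_apply_le_norm_toEuclideanCLM {α : Type*} [Fintype α] [DecidableEq α]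
    (A : Matrix α α ℝ) (i j : α) : |A i j| ≤ ‖Matrix.toEuclideanCLM (𝕜 := ℝ) A‖ := by
  have h1 : (Matrix.toEuclideanCLM (𝕜 := ℝ) A (EuclideanSpace.single j 1)) i = A i j := by
    simp [Matrix.ofLp_toEuclideanCLM]
  have h2 := (Matrix.toEuclideanCLM (𝕜 := ℝ) A).le_opNorm (EuclideanSpace.single j 1)
  rw [PiLp.norm_single, norm_one, mul_one] at h2
  rw [← h1, ← Real.norm_eq_abs]
  exact (PiLp.norm_apply_le _ i).trans h2

/-- If the entries of `A` have all moments, together with their derivatives, and `A⁻¹` has all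
moments, then so do the derivatives of the entries of `A⁻¹`. -/
theorem HasMomentsUpTo.matrix_inv {ι α : Type*} [Fintype ι] [DecidableEq ι] [Fintype α]
    [DecidableEq α] {μ : Measure (ι → ℝ)} [IsFiniteMeasure μ] {A : (ι → ℝ) → Matrix α α ℝ} {m : ℕ}
    (hA : ∀ i j, HasMomentsUpTo μ m (fun w => A w i j)) (hunit : ∀ w, IsUnit (A w))
    (hinv : ∀ p : ℝ, 1 < p →
      Integrable (fun w => ‖Matrix.toEuclideanCLM (𝕜 := ℝ) ((A w)⁻¹)‖ ^ p) μ) (i j : α) :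
    HasMomentsUpTo μ m (fun w => (A w)⁻¹ i j) := by
  have hdet (w : ι → ℝ) : (A w).det ≠ 0 := ((Matrix.isUnit_iff_isUnit_det _).1 (hunit w)).ne_zero
  have hentry (i j : α) (w : ι → ℝ) : (A w)⁻¹ i j = (A w).det⁻¹ * (A w).adjugate i j := by
    simp [Matrix.inv_def]
  have hdetA := HasMomentsUpTo.det hA
  have hsmooth (i j : α) : ContDiff ℝ (⊤ : ℕ∞) (fun w => (A w)⁻¹ i j) := by
    simp only [hentry]
    exact (hdetA.contDiff.inv hdet).mul (HasMomentsUpTo.adjugate hA i j).contDiff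
  have h0 (i j : α) : HasMomentsUpTo μ 0 (fun w => (A w)⁻¹ i j) := by
    have hmeas := (hsmooth i j).continuous.aestronglyMeasurable (μ := μ)
    refine ⟨hsmooth i j, fun p hp =>
      HasMomentsUpTo.memLp_of_integrable_rpow hmeas (fun q hq => ?_) hp⟩
    refine (hinv q hq).mono' ?_ (.of_forall fun w => ?_)
    · exact (hmeas.aemeasurable.abs.pow_const q).aestronglyMeasurable
    · rw [Real.norm_of_nonneg (by positivity)]
      gcongr
      exact Matrix.abs_apply_le_norm_toEuclideanCLM _ i j
  have hdetinv (p : ENNReal) (hp : p ≠ ⊤) : MemLp (fun w => (A w).det⁻¹) p μ := by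
    simpa [Matrix.det_nonsing_inv] using (HasMomentsUpTo.det h0).memLp hp
  simp only [hentry]
  exact (hdetA.inv hdet hdetinv).mul (HasMomentsUpTo.adjugate hA i j)

theorem charFun_map_eq_integral_planeWave {Ω α : Type*} [MeasurableSpace Ω] [Fintype α]
    {μ : Measure Ω} {X : Ω → EuclideanSpace ℝ α} (hX : AEMeasurable X μ)
    (ξ : EuclideanSpace ℝ α) :
    charFun (μ.map X) ξ = ∫ w, planeWave (fun j w => X w j) (fun j => ξ j) w ∂μ := by
  rw [charFun_apply, integral_map hX (by fun_prop)]
  simp [planeWave, PiLp.inner_apply]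

/-- **Theorem 2 (finite-dimensional Malliavin criterion).** Let `μ` be the Gaussian product
measure on `ℝ^N` with independent centered coordinates of variances `δt_k`, let `X : ℝ^N → ℝⁿ`
be smooth with Malliavin matrix `M_{ij}(w) = Σ_k ∂_k X_i(w) ∂_k X_j(w) δt_k` invertible
everywhere, and assume all mixed partial derivatives of `X` as well as `‖M(w)⁻¹‖` have moments
of all orders `p > 1`. Then the law of `X` has a smooth density w.r.t. Lebesgue measure. -/
theorem pushforward_smooth_density_of_invertible_malliavin_matrix
    (n N : ℕ) (δt : Fin N → ℝ) (hδt : ∀ k, 0 < δt k)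
    (μ : Measure (Fin N → ℝ))
    (hμ : μ = Measure.pi fun k => gaussianReal 0 (δt k).toNNReal)
    (X : (Fin N → ℝ) → EuclideanSpace ℝ (Fin n)) (hX : ContDiff ℝ (⊤ : ℕ∞) X)
    (M : (Fin N → ℝ) → Matrix (Fin n) (Fin n) ℝ)
    (hM : ∀ w i j, M w i j =
      ∑ k, fderiv ℝ (fun v => X v i) w (Pi.single k 1) *
            fderiv ℝ (fun v => X v j) w (Pi.single k 1) * δt k)
    (hMinv : ∀ w, IsUnit (M w))
    (hmom : ∀ p : ℝ, 1 < p → ∀ (m : ℕ) (ks : Fin m → Fin N) (i : Fin n),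
      Integrable (fun w =>
        |iteratedFDeriv ℝ m (fun v => X v i) w (fun j => Pi.single (ks j) 1)| ^ p) μ)
    (hMinvmom : ∀ p : ℝ, 1 < p →
      Integrable (fun w => ‖Matrix.toEuclideanCLM (𝕜 := ℝ) ((M w)⁻¹)‖ ^ p) μ) :
    ∃ ρ : EuclideanSpace ℝ (Fin n) → ℝ, ContDiff ℝ (⊤ : ℕ∞) ρ ∧ (∀ x, 0 ≤ ρ x) ∧
      μ.map X = volume.withDensity (fun x => ENNReal.ofReal (ρ x)) := by
  subst hμ
  set v : Fin N → NNReal := fun k => (δt k).toNNReal with hv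
  have hv0 (k : Fin N) : v k ≠ 0 := (Real.toNNReal_pos.2 (hδt k)).ne'
  have hvδ (k : Fin N) : (v k : ℝ) = δt k := Real.coe_toNNReal _ (hδt k).le
  set μ : Measure (Fin N → ℝ) := Measure.pi fun k => gaussianReal 0 (v k) with hμ
  have hXj (j : Fin n) : ContDiff ℝ (⊤ : ℕ∞) (fun w => X w j) :=
    (EuclideanSpace.proj (𝕜 := ℝ) j).contDiff.comp hX
  have hY (j : Fin n) (m : ℕ) : HasMomentsUpTo μ m (fun w => X w j) :=
    .of_integrable_iteratedFDeriv (hXj j) fun p hp r ks => hmom p hp r ks j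
  have hMm (i j : Fin n) (m : ℕ) : HasMomentsUpTo μ m (fun w => M w i j) := by
    simp only [hM]
    exact .sum _ fun k _ =>
      (((hY i (m + 1)).fderiv_single k).mul ((hY j (m + 1)).fderiv_single k)).mul (.const _)
  have hB (i j : Fin n) (m : ℕ) : HasMomentsUpTo μ m (fun w => (M w)⁻¹ i j) :=
    .matrix_inv (fun i j => hMm i j m) hMinv hMinvmom i j
  have hBM (w : Fin N → ℝ) : (M w)⁻¹ * Matrix.of (fun i j =>
      ∑ k, fderiv ℝ (fun v => X v i) w (Pi.single k 1) *
        fderiv ℝ (fun v => X v j) w (Pi.single k 1) * v k) = 1 := by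
    have : Matrix.of (fun i j => ∑ k, fderiv ℝ (fun v => X v i) w (Pi.single k 1) *
        fderiv ℝ (fun v => X v j) w (Pi.single k 1) * v k) = M w := by
      ext i j
      simp only [Matrix.of_apply, hM, hvδ]
    rw [this]
    exact Matrix.nonsing_inv_mul _ ((Matrix.isUnit_iff_isUnit_det _).1 (hMinv w))
  refine exists_contDiff_density_of_charFun_decay (μ.map X) fun r => ?_
  obtain ⟨C, hC⟩ := exists_bound_integral_planeWave v hv0 hY hB hBM r
  refine ⟨C, fun ξ => ?_⟩
  rw [charFun_map_eq_integral_planeWave hX.continuous.aemeasurable, EuclideanSpace.real_norm_sq_eq]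
  exact hC fun j => ξ j
end

section
/- Fix N ∈ ℕ and positive reals δt_1,…,δt_N. Let μ be the Gaussian product measure on ℝ^N under which the coordinates δw_1,…,δw_N are independent centered Gaussians with variances δt_1,…,δt_N; write ∂_k for the partial derivative with respect to the k-th coordinate. Let F_1,…,F_N : ℝ^N → ℝ be smooth functions which, together with all of their partial derivatives of every order, have at most polynomial growth, and set δ(F)(w) = Σ_k F_k(w) δw_k − Σ_k ∂_k F_k(w) δt_k. Then ∫ (δ(F)(w))² μ(dw) = Σ_{k=1}^N ∫ F_k(w)² μ(dw) δt_k + Σ_{k,ℓ=1}^N ∫ ∂_k F_ℓ(w) ∂_ℓ F_k(w) μ(dw) δt_k δt_ℓ, and in particular ∫ (δ(F))² dμ ≤ Σ_k ∫ F_k² dμ δt_k + Σ_{k,ℓ} ∫ (∂_k F_ℓ)² dμ δt_k δt_ℓ. -/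
open MeasureTheory ProbabilityTheory

namespace Function.HasTemperateGrowth

variable {E G : Type*} [NormedAddCommGroup E] [NormedSpace ℝ E]
  [NormedAddCommGroup G] [NormedSpace ℝ G]

theorem fderiv {f : E → G} (hf : f.HasTemperateGrowth) :
    (_root_.fderiv ℝ f).HasTemperateGrowth := by
  refine ⟨hf.1.fderiv_right (by simp), fun n ↦ ?_⟩
  obtain ⟨k, C, h⟩ := hf.2 (n + 1)
  exact ⟨k, C, fun x ↦ by simpa only [norm_iteratedFDeriv_fderiv] using h x⟩

@[fun_prop]
theorem fderiv_apply {f : E → G} (hf : f.HasTemperateGrowth) (v : E) :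
    (fun x ↦ _root_.fderiv ℝ f x v).HasTemperateGrowth :=
  (ContinuousLinearMap.apply ℝ G v).hasTemperateGrowth.comp hf.fderiv

theorem differentiable {f : E → G} (hf : f.HasTemperateGrowth) : Differentiable ℝ f :=
  hf.1.differentiable (by simp)

/-- A function of temperate growth is integrable for a finite measure with finite moments of all
orders. -/
theorem integrable_of_memLp_id [MeasurableSpace E] [BorelSpace E] [SecondCountableTopology E]
    {ν : Measure E} [IsFiniteMeasure ν] (hν : ∀ p : ℕ, MemLp _root_.id p ν)
    {f : E → G} (hf : f.HasTemperateGrowth) : Integrable f ν := by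
  obtain ⟨k, C, h⟩ := hf.2 0
  have hpow : Integrable (fun x : E ↦ C * (1 + ‖x‖) ^ k) ν := by
    have hLp : MemLp (fun x : E ↦ 1 + ‖x‖) k ν := by
      have h1 : MemLp (fun _ : E ↦ (1 : ℝ)) k ν := memLp_const 1
      exact h1.add (hν k).norm
    have hnorm (x : E) : ‖1 + ‖x‖‖ = 1 + ‖x‖ := Real.norm_of_nonneg (by positivity)
    simpa only [hnorm] using hLp.integrable_norm_pow'.const_mul C
  refine hpow.mono' hf.1.continuous.aestronglyMeasurable (.of_forall fun x ↦ ?_)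
  simpa using h x

end Function.HasTemperateGrowth

namespace ProbabilityTheory

open scoped NNReal

theorem hasDerivAt_gaussianPDFReal_zero (v : ℝ≥0) (x : ℝ) :
    HasDerivAt (gaussianPDFReal 0 v) (-(x / v) * gaussianPDFReal 0 v x) x := by
  have h : HasDerivAt (fun y : ℝ ↦ -(y - 0) ^ 2 / (2 * v)) (-(x / v)) x := by
    convert! (((hasDerivAt_id x).sub_const 0).pow 2).neg.div_const (2 * (v : ℝ)) using 1
    simp
    ring
  convert! h.exp.const_mul (√(2 * Real.pi * v))⁻¹ using 1
  rw [gaussianPDFReal]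
  ring

theorem integrable_gaussianReal_iff {v : ℝ≥0} (hv : v ≠ 0) (m : ℝ) {f : ℝ → ℝ} :
    Integrable f (gaussianReal m v) ↔ Integrable (fun x ↦ gaussianPDFReal m v x * f x) := by
  rw [gaussianReal_of_var_ne_zero m hv, integrable_withDensity_iff_integrable_smul'
    (measurable_gaussianPDF m v) (.of_forall fun _ ↦ gaussianPDF_lt_top)]
  simp

theorem _root_.Function.HasTemperateGrowth.integrable_gaussianReal {f : ℝ → ℝ}
    (hf : f.HasTemperateGrowth) (m : ℝ) (v : ℝ≥0) : Integrable f (gaussianReal m v) :=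
  hf.integrable_of_memLp_id fun p ↦ memLp_id_gaussianReal p

/-- **Stein's lemma** for a centered real Gaussian. -/
theorem integral_mul_id_gaussianReal {v : ℝ≥0} (hv : v ≠ 0) {f : ℝ → ℝ}
    (hf : f.HasTemperateGrowth) :
    ∫ x, f x * x ∂gaussianReal 0 v = v * ∫ x, deriv f x ∂gaussianReal 0 v := by
  have hv' : (v : ℝ) ≠ 0 := by exact_mod_cast hv
  have hint {g : ℝ → ℝ} (hg : g.HasTemperateGrowth) :
      Integrable (fun x ↦ gaussianPDFReal 0 v x * g x) :=
    (integrable_gaussianReal_iff hv 0).1 (hg.integrable_gaussianReal 0 v)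
  have hderiv : (deriv f).HasTemperateGrowth := hf.fderiv_apply 1
  have key := integral_mul_deriv_eq_deriv_mul_of_integrable
    (u := f) (u' := deriv f) (v := gaussianPDFReal 0 v)
    (v' := fun x ↦ -(x / v) * gaussianPDFReal 0 v x)
    (fun x _ ↦ hf.differentiable.differentiableAt.hasDerivAt)
    (fun x _ ↦ hasDerivAt_gaussianPDFReal_zero v x)
    ((hint (g := fun x ↦ f x * x * (-(v : ℝ)⁻¹)) (by fun_prop)).congr
      (.of_forall fun x ↦ by simp only [Pi.mul_apply]; ring))
    ((hint hderiv).congr (.of_forall fun x ↦ by simp only [Pi.mul_apply]; ring))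
    ((hint hf).congr (.of_forall fun x ↦ by simp only [Pi.mul_apply]; ring))
  simp only [integral_gaussianReal_eq_integral_smul hv, smul_eq_mul]
  calc ∫ x, gaussianPDFReal 0 v x * (f x * x)
      = ∫ x, -(v : ℝ) * (f x * (-(x / v) * gaussianPDFReal 0 v x)) := by
        congr with x
        field_simp
    _ = v * ∫ x, gaussianPDFReal 0 v x * deriv f x := by
        rw [integral_const_mul, key, neg_mul_neg]
        simp only [mul_comm]

theorem _root_.Function.HasTemperateGrowth.integrable_pi_gaussianReal {ι : Type*} [Fintype ι]
    {f : (ι → ℝ) → ℝ} (hf : f.HasTemperateGrowth) (m : ℝ) (v : ι → ℝ≥0) :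
    Integrable f (Measure.pi fun k ↦ gaussianReal m (v k)) :=
  hf.integrable_of_memLp_id fun p ↦ memLp_pi_iff.2 fun k ↦
    (memLp_id_gaussianReal p).comp_measurePreserving
      (measurePreserving_eval (fun k ↦ gaussianReal m (v k)) k)

@[fun_prop]
theorem hasTemperateGrowth_eval {N : ℕ} (k : Fin N) :
    (fun w : Fin N → ℝ ↦ w k).HasTemperateGrowth :=
  (ContinuousLinearMap.proj (R := ℝ) (φ := fun _ ↦ ℝ) k).hasTemperateGrowth

/-- **Stein's lemma** for a product of centered real Gaussians. -/
theorem integral_mul_eval_pi_gaussianReal {N : ℕ} {v : Fin N → ℝ≥0} (k : Fin N) (hv : v k ≠ 0)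
    {f : (Fin N → ℝ) → ℝ} (hf : f.HasTemperateGrowth) :
    ∫ w, f w * w k ∂Measure.pi (fun k ↦ gaussianReal 0 (v k)) =
      v k * ∫ w, fderiv ℝ f w (Pi.single k 1) ∂Measure.pi (fun k ↦ gaussianReal 0 (v k)) := by
  obtain _ | n := N
  · exact k.elim0
  have hmp := (measurePreserving_piFinSuccAbove (fun k ↦ gaussianReal 0 (v k)) k).symm
  have hfubini {g : (Fin (n + 1) → ℝ) → ℝ} (hg : g.HasTemperateGrowth) :
      ∫ w, g w ∂Measure.pi (fun k ↦ gaussianReal 0 (v k)) =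
        ∫ y, ∫ x, g (k.insertNth (α := fun _ ↦ ℝ) x y) ∂gaussianReal 0 (v k)
          ∂Measure.pi (fun j ↦ gaussianReal 0 (v (k.succAbove j))) := by
    rw [← hmp.integral_comp', integral_prod_symm]
    · rfl
    · exact (hmp.integrable_comp_emb (MeasurableEquiv.measurableEmbedding _)).2
        (hg.integrable_pi_gaussianReal 0 v)
  rw [hfubini (hf.fun_mul (hasTemperateGrowth_eval k)), hfubini (hf.fderiv_apply _), ← integral_const_mul]
  congr with y
  obtain ⟨c, hline⟩ : ∃ c : Fin (n + 1) → ℝ, ∀ x : ℝ,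
      k.insertNth (α := fun _ ↦ ℝ) x y = c + x • Pi.single k 1 := by
    refine ⟨k.insertNth (α := fun _ ↦ ℝ) 0 y, fun x ↦ ?_⟩
    ext j
    refine Fin.succAboveCases k ?_ (fun i ↦ ?_) j <;> simp
  have hg : (fun x : ℝ ↦ f (k.insertNth (α := fun _ ↦ ℝ) x y)).HasTemperateGrowth := by
    simp only [hline]
    exact hf.comp (f := fun x : ℝ ↦ c + x • Pi.single k 1) (by fun_prop)
  simp only [Fin.insertNth_apply_same]
  rw [integral_mul_id_gaussianReal hv hg]
  congr with x
  have hd : HasDerivAt (fun x : ℝ ↦ k.insertNth (α := fun _ ↦ ℝ) x y) (Pi.single k 1) x := by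
    simp only [hline]
    simpa using ((hasDerivAt_id x).smul_const (Pi.single k (1 : ℝ) : Fin (n + 1) → ℝ)).const_add c
  exact (hf.differentiable.differentiableAt.hasFDerivAt.comp_hasDerivAt x hd).deriv

/-- The Skorokhod integral `g δw_k - ∂_k g δt_k` of the process whose only nonzero component is
the `k`-th one, equal to `g`. -/
noncomputable def skorokhodCoord {N : ℕ} (v : Fin N → ℝ≥0) (k : Fin N) (g : (Fin N → ℝ) → ℝ)
    (w : Fin N → ℝ) : ℝ :=
  g w * w k - fderiv ℝ g w (Pi.single k 1) * v k

section skorokhodCoord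

variable {N : ℕ} {v : Fin N → ℝ≥0} {k l : Fin N} {f g : (Fin N → ℝ) → ℝ}

theorem hasTemperateGrowth_skorokhodCoord (hg : g.HasTemperateGrowth) :
    (skorokhodCoord v k g).HasTemperateGrowth := by
  unfold skorokhodCoord
  fun_prop

/-- The Gaussian divergence is adjoint to the partial derivative. -/
theorem integral_mul_skorokhodCoord (hv : v k ≠ 0)
    (hf : f.HasTemperateGrowth) (hg : g.HasTemperateGrowth) :
    ∫ w, f w * skorokhodCoord v k g w ∂Measure.pi (fun k ↦ gaussianReal 0 (v k)) =
      v k * ∫ w, fderiv ℝ f w (Pi.single k 1) * g w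
        ∂Measure.pi (fun k ↦ gaussianReal 0 (v k)) := by
  have hint {h : (Fin N → ℝ) → ℝ} (hh : h.HasTemperateGrowth) :=
    hh.integrable_pi_gaussianReal 0 v
  have stein := integral_mul_eval_pi_gaussianReal k hv (hf.fun_mul hg)
  have hprod (w : Fin N → ℝ) : fderiv ℝ (fun w ↦ f w * g w) w (Pi.single k 1) =
      fderiv ℝ f w (Pi.single k 1) * g w + f w * fderiv ℝ g w (Pi.single k 1) := by
    rw [fderiv_fun_mul hf.differentiable.differentiableAt hg.differentiable.differentiableAt]
    simp
    ring
  simp only [hprod] at stein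
  rw [integral_add (hint (by fun_prop)) (hint (by fun_prop))] at stein
  calc ∫ w, f w * skorokhodCoord v k g w ∂Measure.pi (fun k ↦ gaussianReal 0 (v k))
      = ∫ w, (f w * g w * w k - v k * (f w * fderiv ℝ g w (Pi.single k 1)))
          ∂Measure.pi (fun k ↦ gaussianReal 0 (v k)) := by
        congr with w
        rw [skorokhodCoord]
        ring
    _ = _ := by
        rw [integral_sub (hint (by fun_prop)) (hint (by fun_prop)), stein, integral_const_mul]
        ring

/-- The commutation relation between partial derivatives and the Gaussian divergence. -/
theorem fderiv_skorokhodCoord (hg : g.HasTemperateGrowth) (w : Fin N → ℝ) :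
    fderiv ℝ (skorokhodCoord v l g) w (Pi.single k 1) =
      skorokhodCoord v l (fun w ↦ fderiv ℝ g w (Pi.single k 1)) w +
        if k = l then g w else 0 := by
  have hsymm : fderiv ℝ (fun w ↦ fderiv ℝ g w (Pi.single l 1)) w (Pi.single k 1) =
      fderiv ℝ (fun w ↦ fderiv ℝ g w (Pi.single k 1)) w (Pi.single l 1) := by
    have h2 := hg.fderiv.differentiable.differentiableAt (x := w)
    rw [fderiv_clm_apply h2 (by fun_prop), fderiv_clm_apply h2 (by fun_prop)]
    have h2le : minSmoothness ℝ 2 ≤ (⊤ : ℕ∞) := by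
      simpa using WithTop.coe_le_coe.2 (le_top (a := (2 : ℕ∞)))
    simpa using (hg.1.contDiffAt.isSymmSndFDerivAt h2le).eq (Pi.single k 1) (Pi.single l 1)
  have heval : HasFDerivAt (fun w : Fin N → ℝ ↦ w l)
      (ContinuousLinearMap.proj (R := ℝ) (φ := fun _ ↦ ℝ) l) w :=
    (ContinuousLinearMap.proj (R := ℝ) (φ := fun _ ↦ ℝ) l).hasFDerivAt
  have hpartial := (hg.fderiv_apply (Pi.single l 1)).differentiable.differentiableAt (x := w)
  have h := (hg.differentiable.differentiableAt.hasFDerivAt.mul heval).sub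
    (hpartial.hasFDerivAt.mul_const (v l : ℝ))
  have h' : fderiv ℝ (skorokhodCoord v l g) w = _ := h.fderiv
  rw [h', skorokhodCoord, ← hsymm]
  by_cases hkl : k = l
  · subst hkl
    simp
    ring
  · simp [hkl, Ne.symm hkl]
    ring

theorem integral_skorokhodCoord_mul_skorokhodCoord (hk : v k ≠ 0) (hl : v l ≠ 0)
    (hf : f.HasTemperateGrowth) (hg : g.HasTemperateGrowth) :
    ∫ w, skorokhodCoord v k f w * skorokhodCoord v l g w
        ∂Measure.pi (fun k ↦ gaussianReal 0 (v k)) =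
      (if k = l then (∫ w, f w * g w ∂Measure.pi (fun k ↦ gaussianReal 0 (v k))) * v k else 0) +
        (∫ w, fderiv ℝ g w (Pi.single k 1) * fderiv ℝ f w (Pi.single l 1)
          ∂Measure.pi (fun k ↦ gaussianReal 0 (v k))) * v k * v l := by
  have hint {h : (Fin N → ℝ) → ℝ} (hh : h.HasTemperateGrowth) :=
    hh.integrable_pi_gaussianReal 0 v
  have hgk := hg.fderiv_apply (Pi.single k 1)
  have hsk := hasTemperateGrowth_skorokhodCoord (v := v) (k := l) hgk
  have hadj := integral_mul_skorokhodCoord hk (hasTemperateGrowth_skorokhodCoord (v := v)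
    (k := l) hg) hf
  simp only [mul_comm (skorokhodCoord v k f _)]
  rw [hadj]
  simp only [fderiv_skorokhodCoord hg, add_mul]
  have hadj' := integral_mul_skorokhodCoord hl hf hgk
  simp only [mul_comm (f _) (skorokhodCoord _ _ _ _)] at hadj'
  by_cases hkl : k = l
  · simp only [hkl, if_true] at *
    rw [integral_add (hint (hsk.fun_mul hf)) (hint (hg.fun_mul hf)), hadj']
    simp only [mul_comm (f _), mul_comm (fderiv ℝ f _ _)]
    ring
  · simp only [hkl, if_false, zero_mul, add_zero, zero_add]
    rw [hadj']
    simp only [mul_comm (fderiv ℝ f _ _)]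
    ring

end skorokhodCoord

end ProbabilityTheory

/-- **Proposition 4 (extended Itô isometry for the discrete Skorokhod integral).**
With `δ(F)(w) = Σ_k F_k(w) δw_k − Σ_k ∂_k F_k(w) δt_k`, one has
`∫ (δF)² dμ = Σ_k ∫ F_k² dμ δt_k + Σ_{k,ℓ} ∫ ∂_k F_ℓ ∂_ℓ F_k dμ δt_k δt_ℓ`, and in particular
`∫ (δF)² dμ ≤ Σ_k ∫ F_k² dμ δt_k + Σ_{k,ℓ} ∫ (∂_k F_ℓ)² dμ δt_k δt_ℓ`. -/
theorem skorokhod_isometry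
    (N : ℕ) (δt : Fin N → ℝ) (hδt : ∀ k, 0 < δt k)
    (μ : Measure (Fin N → ℝ))
    (hμ : μ = Measure.pi fun k => gaussianReal 0 (δt k).toNNReal)
    (F : Fin N → (Fin N → ℝ) → ℝ) (hF : ∀ k, ContDiff ℝ (⊤ : ℕ∞) (F k))
    (hFgrowth : ∀ k, ∀ i : ℕ, ∃ C : ℝ, ∃ q : ℕ, ∀ w,
      ‖iteratedFDeriv ℝ i (F k) w‖ ≤ C * (1 + ‖w‖) ^ q)
    (δF : (Fin N → ℝ) → ℝ)
    (hδF : ∀ w, δF w = (∑ k, F k w * w k) -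
      ∑ k, fderiv ℝ (F k) w (Pi.single k 1) * δt k) :
    (∫ w, (δF w) ^ 2 ∂μ
        = (∑ k, (∫ w, (F k w) ^ 2 ∂μ) * δt k)
          + ∑ k, ∑ l, (∫ w, fderiv ℝ (F l) w (Pi.single k 1)
              * fderiv ℝ (F k) w (Pi.single l 1) ∂μ) * δt k * δt l)
    ∧ (∫ w, (δF w) ^ 2 ∂μ
        ≤ (∑ k, (∫ w, (F k w) ^ 2 ∂μ) * δt k)
          + ∑ k, ∑ l, (∫ w, (fderiv ℝ (F l) w (Pi.single k 1)) ^ 2 ∂μ)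
              * δt k * δt l) := by
  have hF' k : (F k).HasTemperateGrowth := ⟨hF k, fun i ↦
    let ⟨C, q, h⟩ := hFgrowth k i
    ⟨q, C, h⟩⟩
  set v : Fin N → NNReal := fun k ↦ (δt k).toNNReal
  have hvt k : (v k : ℝ) = δt k := Real.coe_toNNReal _ (hδt k).le
  have hv0 k : v k ≠ 0 := (Real.toNNReal_pos.2 (hδt k)).ne'
  have hμv : μ = Measure.pi fun k ↦ gaussianReal 0 (v k) := hμ
  have hint {h : (Fin N → ℝ) → ℝ} (hh : h.HasTemperateGrowth) : Integrable h μ :=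
    hμv ▸ hh.integrable_pi_gaussianReal 0 v
  have hsum w : δF w = ∑ k, skorokhodCoord v k (F k) w := by
    simp only [hδF, skorokhodCoord, hvt, Finset.sum_sub_distrib]
  have hiso : ∫ w, (δF w) ^ 2 ∂μ
      = (∑ k, (∫ w, (F k w) ^ 2 ∂μ) * δt k)
        + ∑ k, ∑ l, (∫ w, fderiv ℝ (F l) w (Pi.single k 1)
            * fderiv ℝ (F k) w (Pi.single l 1) ∂μ) * δt k * δt l := by
    have hprod k l : Integrable
        (fun w ↦ skorokhodCoord v k (F k) w * skorokhodCoord v l (F l) w) μ :=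
      hint ((hasTemperateGrowth_skorokhodCoord (hF' k)).fun_mul
        (hasTemperateGrowth_skorokhodCoord (hF' l)))
    simp only [hsum, sq, Finset.sum_mul_sum]
    rw [integral_finsetSum _ fun k _ ↦ integrable_finsetSum _ fun l _ ↦ hprod k l]
    simp only [integral_finsetSum _ fun l _ ↦ hprod _ l]
    simp only [hμv, integral_skorokhodCoord_mul_skorokhodCoord (hv0 _) (hv0 _) (hF' _) (hF' _),
      Finset.sum_add_distrib, Finset.sum_ite_eq, Finset.mem_univ, if_true, hvt]
  refine ⟨hiso, hiso.trans_le (add_le_add_right ?_ _)⟩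
  set A : Fin N → Fin N → ℝ := fun k l ↦
    (∫ w, (fderiv ℝ (F l) w (Pi.single k 1)) ^ 2 ∂μ) * δt k * δt l with hA
  have hAM k l : (∫ w, fderiv ℝ (F l) w (Pi.single k 1)
      * fderiv ℝ (F k) w (Pi.single l 1) ∂μ) * δt k * δt l ≤ (A k l + A l k) / 2 := by
    have hi k l : Integrable (fun w ↦ (fderiv ℝ (F l) w (Pi.single k 1)) ^ 2) μ :=
      hint (((hF' l).fderiv_apply _).fun_pow 2)
    have hle : ∫ w, fderiv ℝ (F l) w (Pi.single k 1) * fderiv ℝ (F k) w (Pi.single l 1) ∂μ ≤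
        ∫ w, ((fderiv ℝ (F l) w (Pi.single k 1)) ^ 2
          + (fderiv ℝ (F k) w (Pi.single l 1)) ^ 2) / 2 ∂μ :=
      integral_mono (hint (((hF' l).fderiv_apply _).fun_mul ((hF' k).fderiv_apply _)))
        (((hi k l).add (hi l k)).div_const 2) fun w ↦ by
          have := two_mul_le_add_sq (fderiv ℝ (F l) w (Pi.single k 1))
            (fderiv ℝ (F k) w (Pi.single l 1))
          simp only
          linarith
    rw [integral_div, integral_add (hi k l) (hi l k)] at hle
    have := mul_le_mul_of_nonneg_right hle (mul_pos (hδt k) (hδt l)).le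
    simp only [hA]
    linarith
  calc _ ≤ ∑ k, ∑ l, (A k l + A l k) / 2 :=
        Finset.sum_le_sum fun k _ ↦ Finset.sum_le_sum fun l _ ↦ hAM k l
    _ = ∑ k, ∑ l, A k l := by
        simp only [← Finset.sum_div, Finset.sum_add_distrib]
        rw [Finset.sum_comm (f := fun k l ↦ A l k), add_self_div_two]
end

section
/- Let n ≥ 1 and let M be a random n×n real matrix (a measurable map from a probability space to the n×n matrices) which is almost surely symmetric and positive semidefinite. Assume that E‖M‖^p < ∞ for every p ≥ 1, and that for every p ≥ 1 there exists a constant C_p such that sup_{|η|=1} P(⟨η, Mη⟩ < ε) ≤ C_p ε^p for every ε ∈ (0,1], where the supremum is over unit vectors η ∈ ℝⁿ. Then M is almost surely invertible and E‖M^{-1}‖^p < ∞ for every p ≥ 1. -/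
open MeasureTheory
open scoped RealInnerProductSpace

/-- A positive quadratic form at `g` is at most twice its value at `v` plus twice its value at
`g - v`. -/
lemma inner_apply_le_two_mul_add {E : Type*} [NormedAddCommGroup E] [InnerProductSpace ℝ E]
    (T : E →L[ℝ] E) (hT : ∀ x, 0 ≤ ⟪x, T x⟫) (g v : E) :
    ⟪g, T g⟫ ≤ 2 * ⟪v, T v⟫ + 2 * ⟪g - v, T (g - v)⟫ := by
  have h := hT (g - (2 : ℝ) • v)
  simp only [map_sub, map_smul, inner_sub_left, inner_sub_right, inner_smul_left,
    inner_smul_right, RCLike.conj_to_real] at h ⊢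
  linarith

/-- A grid of mesh `1 / (n * k)` in the cube `[-1, 1]ⁿ` is a `1 / k`-net of the unit sphere. -/
lemma exists_finset_net_sphere (n : ℕ) (hn : 1 ≤ n) (k : ℕ) (hk : 1 ≤ k) :
    ∃ S : Finset (EuclideanSpace ℝ (Fin n)), S.card ≤ (2 * (n * k) + 1) ^ n ∧
      ∀ v : EuclideanSpace ℝ (Fin n), ‖v‖ = 1 → ∃ g ∈ S, ‖g - v‖ ≤ 1 / (k : ℝ) := by
  classical
  set N := n * k with hN
  have hNpos : (0 : ℝ) < N := by
    have : 0 < N := Nat.mul_pos hn hk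
    exact_mod_cast this
  let G : (Fin n → Fin (2 * N + 1)) → EuclideanSpace ℝ (Fin n) :=
    fun κ => WithLp.toLp 2 fun i => ((κ i : ℕ) : ℝ) / N - 1
  refine ⟨Finset.univ.image G, ?_, fun v hv => ?_⟩
  · refine Finset.card_image_le.trans ?_
    simp
  · have hvi : ∀ i, |v i| ≤ 1 := fun i => by
      have := PiLp.norm_apply_le v i
      rwa [hv, Real.norm_eq_abs] at this
    have hlt : ∀ i, ⌊(v i + 1) * N⌋₊ < 2 * N + 1 := fun i => by
      refine Nat.lt_succ_of_le (Nat.floor_le_of_le ?_)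
      push_cast
      have := (abs_le.1 (hvi i)).2
      nlinarith
    refine ⟨G fun i => ⟨⌊(v i + 1) * N⌋₊, hlt i⟩, Finset.mem_image_of_mem _ (Finset.mem_univ _), ?_⟩
    refine abs_le_of_sq_le_sq' ?_ (by positivity) |>.2
    rw [EuclideanSpace.norm_sq_eq]
    have hterm : ∀ i, ‖(G (fun i => ⟨⌊(v i + 1) * N⌋₊, hlt i⟩) - v) i‖ ^ 2
        ≤ (1 / (N : ℝ)) ^ 2 := fun i => by
      rw [Real.norm_eq_abs]
      refine pow_le_pow_left₀ (abs_nonneg _) ?_ 2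
      have h0 : 0 ≤ (v i + 1) * N := mul_nonneg (by linarith [(abs_le.1 (hvi i)).1]) hNpos.le
      have h1 := Nat.floor_le h0
      have h2 := Nat.lt_floor_add_one ((v i + 1) * N)
      have heq : (G (fun i => ⟨⌊(v i + 1) * N⌋₊, hlt i⟩) - v) i
          = (⌊(v i + 1) * N⌋₊ - (v i + 1) * N) / N := by
        simp only [G, PiLp.sub_apply]
        field_simp
        ring
      rw [heq, abs_div, abs_of_pos hNpos]
      gcongr
      rw [abs_le]
      constructor <;> linarith
    refine (Finset.sum_le_sum fun i _ => hterm i).trans ?_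
    simp only [Finset.sum_const, Finset.card_univ, Fintype.card_fin, nsmul_eq_mul]
    have hn' : (1 : ℝ) ≤ n := by exact_mod_cast hn
    have hk' : (0 : ℝ) < k := by exact_mod_cast hk
    rw [hN]
    push_cast
    rw [div_pow, div_pow, mul_pow, one_pow, mul_one_div,
      div_le_div_iff₀ (by positivity) (by positivity)]
    nlinarith [mul_nonneg (sub_nonneg.2 hn') (by positivity : (0 : ℝ) ≤ n * k ^ 2)]

/-- Polynomial decay of the tail of a nonnegative random variable gives finite moments. -/
lemma integrable_rpow_of_tail_le {Ω : Type*} [MeasurableSpace Ω] (P : Measure Ω)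
    [IsFiniteMeasure P] (X : Ω → ℝ) (hX : Measurable X) (hX0 : ∀ ω, 0 ≤ X ω)
    (p : ℝ) (hp : 0 ≤ p) (a : ℝ) (ha : 0 < a) (K : ℝ) (hK : 0 ≤ K)
    (htail : ∀ m : ℕ, P {ω | a * ((m : ℝ) + 1) < X ω}
      ≤ ENNReal.ofReal (K * ((m : ℝ) + 1) ^ (-(p + 2)))) :
    Integrable (fun ω => X ω ^ p) P := by
  refine ⟨(hX.pow_const p).aestronglyMeasurable, ?_⟩
  rw [hasFiniteIntegral_iff_ofReal (Filter.Eventually.of_forall fun ω => Real.rpow_nonneg (hX0 ω) p)]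
  let s : ℕ → Set Ω := fun m => {ω | a * ((m : ℝ) + 1) < X ω}
  have hs : ∀ m, MeasurableSet (s m) := fun m => measurableSet_lt measurable_const hX
  let c : ℕ → ℝ := fun m => (2 * a) ^ p * ((m : ℝ) + 1) ^ p
  have hpt : ∀ ω, ENNReal.ofReal (X ω ^ p) ≤ ENNReal.ofReal (a ^ p) +
      ∑' m, (s m).indicator (fun _ => ENNReal.ofReal (c m)) ω := by
    intro ω
    rcases le_or_gt (X ω) a with h | h
    · exact le_add_right (ENNReal.ofReal_le_ofReal (Real.rpow_le_rpow (hX0 ω) h hp))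
    · have h1 : 1 < X ω / a := by rwa [lt_div_iff₀ ha, one_mul]
      have h2 : 1 < ⌈X ω / a⌉₊ := Nat.lt_ceil.2 (by exact_mod_cast h1)
      obtain ⟨m, hm⟩ := Nat.exists_eq_add_of_le h2
      have h3 : (m : ℝ) + 1 < X ω / a := by
        have : m + 1 < ⌈X ω / a⌉₊ := by omega
        exact_mod_cast Nat.lt_ceil.1 this
      have h4 : X ω / a ≤ (m : ℝ) + 2 := by
        refine (Nat.le_ceil _).trans ?_
        rw [hm]
        push_cast
        linarith
      have hmem : ω ∈ s m := by
        change a * ((m : ℝ) + 1) < X ω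
        rwa [lt_div_iff₀ ha, mul_comm] at h3
      refine le_add_left (le_trans ?_ (ENNReal.le_tsum m))
      rw [Set.indicator_of_mem hmem]
      refine ENNReal.ofReal_le_ofReal ?_
      change _ ≤ (2 * a) ^ p * ((m : ℝ) + 1) ^ p
      rw [← Real.mul_rpow (by positivity) (by positivity)]
      refine Real.rpow_le_rpow (hX0 ω) ?_ hp
      rw [div_le_iff₀ ha] at h4
      nlinarith [mul_nonneg ha.le (Nat.cast_nonneg (α := ℝ) m)]
  refine (lintegral_mono hpt).trans_lt ?_
  rw [lintegral_add_left measurable_const, lintegral_const,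
    lintegral_tsum fun m => (measurable_const.indicator (hs m)).aemeasurable]
  refine ENNReal.add_lt_top.2 ⟨ENNReal.mul_lt_top ENNReal.ofReal_lt_top (measure_lt_top _ _), ?_⟩
  have hle : ∀ m : ℕ, ∫⁻ ω, (s m).indicator (fun _ => ENNReal.ofReal (c m)) ω ∂P
      ≤ ENNReal.ofReal ((2 * a) ^ p * K * ((m : ℝ) + 1) ^ (-2 : ℝ)) := by
    intro m
    have hm : (0 : ℝ) < (m : ℝ) + 1 := by positivity
    rw [lintegral_indicator_const (hs m)]
    refine (mul_le_mul_right (htail m) _).trans ?_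
    rw [← ENNReal.ofReal_mul (by positivity)]
    refine ENNReal.ofReal_le_ofReal (le_of_eq ?_)
    have : ((m : ℝ) + 1) ^ (-2 : ℝ) = ((m : ℝ) + 1) ^ p * ((m : ℝ) + 1) ^ (-(p + 2)) := by
      rw [← Real.rpow_add hm]
      ring_nf
    rw [this]
    simp only [c]
    ring
  refine (ENNReal.tsum_le_tsum hle).trans_lt ?_
  have hsum : Summable fun m : ℕ => (2 * a) ^ p * K * ((m : ℝ) + 1) ^ (-2 : ℝ) := by
    refine Summable.mul_left _ ?_
    have := (summable_nat_add_iff 1).2 (Real.summable_nat_rpow.2 (by norm_num : (-2 : ℝ) < -1))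
    simpa using this
  rw [← ENNReal.ofReal_tsum_of_nonneg (fun m => by positivity) hsum]
  exact ENNReal.ofReal_lt_top

/-- The operator norm of the inverse of a random matrix is measurable. -/
lemma measurable_norm_toEuclideanCLM_inv {n : ℕ} {Ω : Type*} [MeasurableSpace Ω]
    (M : Ω → Matrix (Fin n) (Fin n) ℝ) (hM : ∀ i j, Measurable fun ω => M ω i j) :
    Measurable fun ω => ‖Matrix.toEuclideanCLM (𝕜 := ℝ) ((M ω)⁻¹)‖ := by
  have hdet : ∀ N : Ω → Matrix (Fin n) (Fin n) ℝ, (∀ i j, Measurable fun ω => N ω i j) →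
      Measurable fun ω => (N ω).det := fun N hN => by
    simp only [Matrix.det_apply']
    exact Finset.measurable_sum _ fun σ _ =>
      (Finset.measurable_prod _ fun i _ => hN (σ i) i).const_mul _
  have hinv : ∀ i j, Measurable fun ω => (M ω)⁻¹ i j := fun i j => by
    simp only [Matrix.inv_def, Matrix.smul_apply, smul_eq_mul, Ring.inverse_eq_inv',
      Matrix.adjugate_apply]
    refine (hdet M hM).inv.mul (hdet _ fun k l => ?_)
    by_cases h : k = j
    · subst h
      simp
    · simpa [Matrix.updateRow_ne h] using hM k l
  have heq : ∀ ω, Matrix.toEuclideanCLM (𝕜 := ℝ) ((M ω)⁻¹)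
      = ∑ i, ∑ j, (M ω)⁻¹ i j • Matrix.toEuclideanCLM (𝕜 := ℝ) (Matrix.single i j (1 : ℝ)) := by
    intro ω
    conv_lhs => rw [Matrix.matrix_eq_sum_single ((M ω)⁻¹)]
    simp only [map_sum]
    refine Finset.sum_congr rfl fun i _ => Finset.sum_congr rfl fun j _ => ?_
    rw [← map_smul, Matrix.smul_single, smul_eq_mul, mul_one]
  simp only [heq]
  have hc : Continuous fun N : Fin n → Fin n → ℝ =>
      ‖∑ i, ∑ j, N i j • Matrix.toEuclideanCLM (𝕜 := ℝ) (Matrix.single i j (1 : ℝ))‖ := by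
    fun_prop
  exact hc.measurable.comp (measurable_pi_lambda _ fun i => measurable_pi_lambda _ fun j => hinv i j)

/-- A lower bound for the quadratic form of a matrix on the unit sphere bounds its inverse. -/
lemma isUnit_and_norm_inv_le_of_le_inner {n : ℕ} (A : Matrix (Fin n) (Fin n) ℝ) (ε : ℝ)
    (hε : 0 < ε) (h : ∀ v : EuclideanSpace ℝ (Fin n), ‖v‖ = 1 →
      ε ≤ ⟪v, Matrix.toEuclideanCLM (𝕜 := ℝ) A v⟫) :
    IsUnit A ∧ ‖Matrix.toEuclideanCLM (𝕜 := ℝ) A⁻¹‖ ≤ 1 / ε := by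
  set T := Matrix.toEuclideanCLM (𝕜 := ℝ) A with hT
  have hlow : ∀ x, ε * ‖x‖ ≤ ‖T x‖ := fun x => by
    rcases eq_or_ne x 0 with rfl | hx
    · simp
    have hx' : 0 < ‖x‖ := norm_pos_iff.2 hx
    have h1 := h (‖x‖⁻¹ • x) (norm_smul_inv_norm hx)
    have h2 := h1.trans (real_inner_le_norm _ _)
    rw [map_smul, norm_smul, norm_smul, norm_inv, norm_norm, inv_mul_cancel₀ hx'.ne', one_mul,
      inv_mul_eq_div, le_div_iff₀ hx'] at h2
    exact h2
  have hinj : ∀ x, T x = 0 → x = 0 := fun x hx => by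
    have h1 := hlow x
    rw [hx, norm_zero] at h1
    exact norm_le_zero_iff.1 (nonpos_of_mul_nonpos_right h1 hε)
  have hU : IsUnit A := by
    rw [← Matrix.mulVec_injective_iff_isUnit]
    intro x y hxy
    have h1 : T (WithLp.toLp 2 (x - y)) = 0 := by
      rw [hT, Matrix.toEuclideanCLM_toLp, Matrix.mulVec_sub, hxy, sub_self, WithLp.toLp_zero]
    have h2 := congrArg WithLp.ofLp (hinj _ h1)
    exact sub_eq_zero.1 h2
  refine ⟨hU, ContinuousLinearMap.opNorm_le_bound _ (by positivity) fun x => ?_⟩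
  have h1 := hlow (Matrix.toEuclideanCLM (𝕜 := ℝ) A⁻¹ x)
  have h2 : T (Matrix.toEuclideanCLM (𝕜 := ℝ) A⁻¹ x) = x := by
    rw [hT, ← mul_apply_eq_comp, ← map_mul,
      Matrix.mul_nonsing_inv _ ((Matrix.isUnit_iff_isUnit_det _).1 hU), map_one,
      one_apply_eq_self]
  rw [h2] at h1
  rw [one_div, inv_mul_eq_div, le_div_iff₀ hε, mul_comm]
  exact h1

/-- If `T` is positive, `‖T‖ ≤ k` and its quadratic form is below `1 / k` at a unit vector `v`,
then it is below `16 / k` at the normalization of every `g` that is `1 / k`-close to `v`. -/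
lemma inner_normalize_lt_of_close {E : Type*} [NormedAddCommGroup E] [InnerProductSpace ℝ E]
    (T : E →L[ℝ] E) (hT : ∀ x, 0 ≤ ⟪x, T x⟫) (k : ℝ) (hk : 2 ≤ k) (hTk : ‖T‖ ≤ k)
    (v g : E) (hv : ‖v‖ = 1) (hgv : ‖g - v‖ ≤ 1 / k) (hlt : ⟪v, T v⟫ < 1 / k) :
    g ≠ 0 ∧ ⟪‖g‖⁻¹ • g, T (‖g‖⁻¹ • g)⟫ < 16 / k := by
  have hk0 : 0 < k := by linarith
  have hg : 1 / 2 ≤ ‖g‖ := by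
    have h1 : ‖v‖ - ‖g‖ ≤ ‖g - v‖ := by
      rw [norm_sub_rev]
      exact norm_sub_norm_le v g
    have h2 : 1 / k ≤ 1 / 2 := one_div_le_one_div_of_le (by norm_num) hk
    linarith
  have hg0 : 0 < ‖g‖ := by linarith
  refine ⟨norm_pos_iff.1 hg0, ?_⟩
  have hw : ⟪g - v, T (g - v)⟫ ≤ 1 / k := calc
    ⟪g - v, T (g - v)⟫ ≤ ‖g - v‖ * ‖T (g - v)‖ := real_inner_le_norm _ _
    _ ≤ (1 / k) * (k * (1 / k)) := by
        gcongr
        exact (T.le_opNorm _).trans (by gcongr)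
    _ = 1 / k := by field_simp
  have hq : ⟪g, T g⟫ < 4 * (1 / k) := by
    linarith [inner_apply_le_two_mul_add T hT g v]
  rw [map_smul, inner_smul_left, inner_smul_right, RCLike.conj_to_real, ← mul_assoc]
  have hinv : ‖g‖⁻¹ ≤ 2 := by
    rw [inv_le_comm₀ hg0 (by norm_num)]
    linarith
  have hinv0 : 0 < ‖g‖⁻¹ := by positivity
  calc ‖g‖⁻¹ * ‖g‖⁻¹ * ⟪g, T g⟫ ≤ 2 * 2 * ⟪g, T g⟫ := by
        gcongr
        exact hT g
    _ < 16 / k := by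
        rw [mul_one_div] at hq
        have : 16 / k = 4 * (4 / k) := by ring
        linarith

/-- Under uniform small-ball estimates in each direction, the probability that the quadratic form
of `M` is small somewhere on the unit sphere decays faster than any power. -/
lemma exists_measure_exists_inner_lt_le
    (n : ℕ) (hn : 1 ≤ n) {Ω : Type*} [MeasurableSpace Ω] (P : Measure Ω) [IsProbabilityMeasure P]
    (M : Ω → Matrix (Fin n) (Fin n) ℝ) (hpsd : ∀ᵐ ω ∂P, (M ω).PosSemidef)
    (hmom : ∀ p : ℝ, 1 ≤ p →
      Integrable (fun ω => ‖Matrix.toEuclideanCLM (𝕜 := ℝ) (M ω)‖ ^ p) P)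
    (hsmall : ∀ p : ℝ, 1 ≤ p → ∃ C : ℝ, ∀ ε : ℝ, 0 < ε → ε ≤ 1 →
      ∀ η : EuclideanSpace ℝ (Fin n), ‖η‖ = 1 →
        P {ω | ⟪η, Matrix.toEuclideanCLM (𝕜 := ℝ) (M ω) η⟫ < ε}
          ≤ ENNReal.ofReal (C * ε ^ p))
    (r : ℝ) (hr : 1 ≤ r) :
    ∃ K : ℝ, 0 ≤ K ∧ ∀ m : ℕ, 1 ≤ m →
      P {ω | ∃ v : EuclideanSpace ℝ (Fin n), ‖v‖ = 1 ∧
          ⟪v, Matrix.toEuclideanCLM (𝕜 := ℝ) (M ω) v⟫ < 1 / (16 * (m : ℝ))}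
        ≤ ENNReal.ofReal (K * (m : ℝ) ^ (-r)) := by
  classical
  obtain ⟨C, hC⟩ := hsmall (r + n) (by linarith [Nat.cast_nonneg (α := ℝ) n])
  set I := ∫ ω, ‖Matrix.toEuclideanCLM (𝕜 := ℝ) (M ω)‖ ^ r ∂P
  have hI0 : 0 ≤ I := integral_nonneg fun ω => by positivity
  refine ⟨(33 * n) ^ n * |C| + I, by positivity, fun m hm => ?_⟩
  have hm1 : (1 : ℝ) ≤ m := by exact_mod_cast hm
  have hm0 : (0 : ℝ) < m := by linarith
  have hn1 : (1 : ℝ) ≤ n := by exact_mod_cast hn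
  obtain ⟨S, hScard, hS⟩ := exists_finset_net_sphere n hn (16 * m) (by omega)
  set S' := S.filter (· ≠ 0)
  let B : EuclideanSpace ℝ (Fin n) → Set Ω := fun g =>
    {ω | ⟪‖g‖⁻¹ • g, Matrix.toEuclideanCLM (𝕜 := ℝ) (M ω) (‖g‖⁻¹ • g)⟫ < 1 / (m : ℝ)}
  let L : Set Ω := {ω | (m : ℝ) ^ r ≤ ‖Matrix.toEuclideanCLM (𝕜 := ℝ) (M ω)‖ ^ r}
  have hsub : P {ω | ∃ v : EuclideanSpace ℝ (Fin n), ‖v‖ = 1 ∧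
      ⟪v, Matrix.toEuclideanCLM (𝕜 := ℝ) (M ω) v⟫ < 1 / (16 * (m : ℝ))}
      ≤ P ((⋃ g ∈ S', B g) ∪ L) := by
    refine measure_mono_ae ?_
    filter_upwards [hpsd] with ω hω hbad
    obtain ⟨v, hv, hlt⟩ := hbad
    have hpos : ∀ x, 0 ≤ ⟪x, Matrix.toEuclideanCLM (𝕜 := ℝ) (M ω) x⟫ := fun x => by
      rw [Matrix.inner_toEuclideanCLM]
      simpa using hω.dotProduct_mulVec_nonneg x.ofLp
    rcases le_or_gt (m : ℝ) ‖Matrix.toEuclideanCLM (𝕜 := ℝ) (M ω)‖ with hL | hL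
    · exact Or.inr (Real.rpow_le_rpow hm0.le hL (by linarith))
    · obtain ⟨g, hgS, hgv⟩ := hS v hv
      push_cast at hgv
      obtain ⟨hg0, hg⟩ := inner_normalize_lt_of_close _ hpos (16 * m) (by linarith)
        (by linarith) v g hv hgv hlt
      refine Or.inl (Set.mem_biUnion (Finset.mem_coe.2 (Finset.mem_filter.2 ⟨hgS, hg0⟩)) ?_)
      change _ < 1 / (m : ℝ)
      refine hg.trans_eq ?_
      field_simp
  have hB : ∀ g ∈ S', P (B g) ≤ ENNReal.ofReal (|C| * (m : ℝ) ^ (-(r + n))) := fun g hg => by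
    have hg0 : g ≠ 0 := (Finset.mem_filter.1 hg).2
    refine (hC (1 / m) (by positivity) ((div_le_one hm0).2 hm1) _
      (norm_smul_inv_norm hg0)).trans (ENNReal.ofReal_le_ofReal ?_)
    rw [one_div, Real.inv_rpow hm0.le, ← Real.rpow_neg hm0.le]
    gcongr
    exact le_abs_self C
  have hL : P L ≤ ENNReal.ofReal (I * (m : ℝ) ^ (-r)) := by
    have h1 := mul_meas_ge_le_integral_of_nonneg
      (Filter.Eventually.of_forall fun ω => by positivity) (hmom r hr) ((m : ℝ) ^ r)
    rw [← ofReal_measureReal]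
    refine ENNReal.ofReal_le_ofReal ?_
    rw [Real.rpow_neg hm0.le, ← div_eq_mul_inv, le_div_iff₀ (by positivity), mul_comm]
    exact h1
  have hcard : (S'.card : ℝ) ≤ (33 * n) ^ n * (m : ℝ) ^ (n : ℝ) := by
    have h1 : (S'.card : ℝ) ≤ (2 * (n * (16 * m)) + 1) ^ n := by
      exact_mod_cast (Finset.card_filter_le _ _).trans hScard
    rw [Real.rpow_natCast, ← mul_pow]
    refine h1.trans (pow_le_pow_left₀ (by positivity) ?_ n)
    nlinarith
  calc _ ≤ P ((⋃ g ∈ S', B g) ∪ L) := hsub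
    _ ≤ P (⋃ g ∈ S', B g) + P L := measure_union_le _ _
    _ ≤ ∑ g ∈ S', P (B g) + P L := by
        gcongr
        exact measure_biUnion_finset_le _ _
    _ ≤ S'.card • ENNReal.ofReal (|C| * (m : ℝ) ^ (-(r + n)))
          + ENNReal.ofReal (I * (m : ℝ) ^ (-r)) := by
        gcongr
        exact Finset.sum_le_card_nsmul _ _ _ hB
    _ = ENNReal.ofReal (S'.card * (|C| * (m : ℝ) ^ (-(r + n))) + I * (m : ℝ) ^ (-r)) := by
        rw [ENNReal.ofReal_add (by positivity) (by positivity),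
          ENNReal.ofReal_mul (p := (S'.card : ℝ)) (by positivity), ENNReal.ofReal_natCast,
          nsmul_eq_mul]
    _ ≤ _ := by
        refine ENNReal.ofReal_le_ofReal ?_
        rw [add_mul]
        refine add_le_add ?_ le_rfl
        have hsplit : (m : ℝ) ^ (-r) = (m : ℝ) ^ (n : ℝ) * (m : ℝ) ^ (-(r + n)) := by
          rw [← Real.rpow_add hm0]
          ring_nf
        rw [hsplit]
        calc _ ≤ ((33 * n) ^ n * (m : ℝ) ^ (n : ℝ)) * (|C| * (m : ℝ) ^ (-(r + n))) := by gcongr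
          _ = _ := by ring

/-- **Lemma 6 (inverse moments of a random positive semidefinite matrix).** If `M` is an a.s.
symmetric positive semidefinite random matrix with moments of all orders and
`sup_{|η|=1} P(⟨η, Mη⟩ < ε) ≤ C_p ε^p` for every `p ≥ 1` and `ε ∈ (0,1]`, then `M` is a.s.
invertible and `E‖M⁻¹‖^p < ∞` for every `p ≥ 1`. -/
theorem inverse_moments_of_random_psd_matrix
    (n : ℕ) (hn : 1 ≤ n)
    {Ω : Type*} [MeasurableSpace Ω] (P : Measure Ω) [IsProbabilityMeasure P]
    (M : Ω → Matrix (Fin n) (Fin n) ℝ) (hMmeas : ∀ i j, Measurable fun ω => M ω i j)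
    (hpsd : ∀ᵐ ω ∂P, (M ω).PosSemidef)
    (hmom : ∀ p : ℝ, 1 ≤ p →
      Integrable (fun ω => ‖Matrix.toEuclideanCLM (𝕜 := ℝ) (M ω)‖ ^ p) P)
    (hsmall : ∀ p : ℝ, 1 ≤ p → ∃ C : ℝ, ∀ ε : ℝ, 0 < ε → ε ≤ 1 →
      ∀ η : EuclideanSpace ℝ (Fin n), ‖η‖ = 1 →
        P {ω | ⟪η, Matrix.toEuclideanCLM (𝕜 := ℝ) (M ω) η⟫ < ε}
          ≤ ENNReal.ofReal (C * ε ^ p)) :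
    (∀ᵐ ω ∂P, IsUnit (M ω)) ∧
      ∀ p : ℝ, 1 ≤ p →
        Integrable (fun ω => ‖Matrix.toEuclideanCLM (𝕜 := ℝ) ((M ω)⁻¹)‖ ^ p) P := by
  have hgood : ∀ m : ℕ, 1 ≤ m → ∀ ω, ¬ (∃ v : EuclideanSpace ℝ (Fin n), ‖v‖ = 1 ∧
      ⟪v, Matrix.toEuclideanCLM (𝕜 := ℝ) (M ω) v⟫ < 1 / (16 * (m : ℝ))) →
      IsUnit (M ω) ∧ ‖Matrix.toEuclideanCLM (𝕜 := ℝ) ((M ω)⁻¹)‖ ≤ 16 * (m : ℝ) := by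
    intro m hm ω h
    push Not at h
    have hm0 : (0 : ℝ) < m := by exact_mod_cast hm
    have := isUnit_and_norm_inv_le_of_le_inner (M ω) (1 / (16 * (m : ℝ))) (by positivity) h
    rwa [one_div_one_div] at this
  constructor
  · obtain ⟨K, -, hK⟩ := exists_measure_exists_inner_lt_le n hn P M hpsd hmom hsmall 1 le_rfl
    rw [ae_iff]
    have hle : ∀ m : ℕ, P {ω | ¬ IsUnit (M ω)} ≤ ENNReal.ofReal (K * (1 / ((m : ℝ) + 1))) := by
      intro m
      have h1 := hK (m + 1) (by omega)
      rw [Real.rpow_neg_one, ← one_div] at h1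
      push_cast at h1
      refine (measure_mono fun ω hω => ?_).trans h1
      by_contra hcon
      refine hω (hgood (m + 1) (by omega) ω ?_).1
      push_cast
      exact hcon
    have hlim : Filter.Tendsto (fun m : ℕ => ENNReal.ofReal (K * (1 / ((m : ℝ) + 1))))
        Filter.atTop (nhds 0) := by
      have h1 := (tendsto_one_div_add_atTop_nhds_zero_nat (𝕜 := ℝ)).const_mul K
      rw [mul_zero] at h1
      simpa using ENNReal.tendsto_ofReal h1
    exact le_antisymm (ge_of_tendsto' hlim hle) zero_le
  · intro p hp
    obtain ⟨K, hK0, hK⟩ :=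
      exists_measure_exists_inner_lt_le n hn P M hpsd hmom hsmall (p + 2) (by linarith)
    refine integrable_rpow_of_tail_le P _ (measurable_norm_toEuclideanCLM_inv M hMmeas)
      (fun ω => norm_nonneg _) p (by linarith) 16 (by norm_num) K hK0 fun m => ?_
    have h1 := hK (m + 1) (by omega)
    push_cast at h1
    refine (measure_mono fun ω hω => ?_).trans h1
    by_contra hcon
    have h2 := (hgood (m + 1) (by omega) ω (by push_cast; exact hcon)).2
    push_cast at h2
    exact absurd hω (not_lt.2 h2)
end

section
/- Let f : [0,1] → ℝ be continuously differentiable and let α ∈ (0,1]. Assume the derivative f′ is α-Hölder continuous, and let ‖f′‖_α denote its best α-Hölder constant, i.e. the smallest K with |f′(s) − f′(t)| ≤ K|s−t|^α for all s,t ∈ [0,1]. Then ‖f′‖_∞ ≤ 4 max{ ‖f‖_∞ , ‖f‖_∞^{α/(1+α)} ‖f′‖_α^{1/(1+α)} }, where ‖·‖_∞ denotes the supremum norm on [0,1]. -/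
/-- A derivative with an `α`-Hölder modulus on `[0,1]` is bounded, at every scale `h ≤ 1`, by the
difference quotient at that scale plus the oscillation of the derivative. -/
theorem abs_deriv_le_div_add_of_holder {f f' : ℝ → ℝ} {α K M h t : ℝ} (hα : 0 ≤ α) (hK : 0 ≤ K)
    (hderiv : ∀ t ∈ Set.Icc (0 : ℝ) 1, HasDerivWithinAt f (f' t) (Set.Icc (0 : ℝ) 1) t)
    (hM : ∀ t ∈ Set.Icc (0 : ℝ) 1, |f t| ≤ M)
    (hf' : ∀ s ∈ Set.Icc (0 : ℝ) 1, ∀ t ∈ Set.Icc (0 : ℝ) 1, |f' s - f' t| ≤ K * |s - t| ^ α)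
    (h0 : 0 < h) (h1 : h ≤ 1) (ht : t ∈ Set.Icc (0 : ℝ) 1) :
    |f' t| ≤ 2 * M / h + K * h ^ α := by
  obtain ⟨a, ha0, hat, hta, hah⟩ : ∃ a, 0 ≤ a ∧ a ≤ t ∧ t ≤ a + h ∧ a + h ≤ 1 := by
    rcases le_total t (1 - h) with hth | hth
    · exact ⟨t, ht.1, le_rfl, by linarith, by linarith⟩
    · exact ⟨1 - h, by linarith, hth, by linarith [ht.2], by linarith⟩
  have hsub : Set.Icc a (a + h) ⊆ Set.Icc (0 : ℝ) 1 := Set.Icc_subset_Icc ha0 hah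
  obtain ⟨ξ, hξ, hslope⟩ := exists_hasDerivAt_eq_slope f f' (by linarith : a < a + h)
    (fun x hx => ((hderiv x (hsub hx)).continuousWithinAt).mono hsub)
    (fun x hx => (hderiv x (hsub (Set.Ioo_subset_Icc_self hx))).hasDerivAt
      (Icc_mem_nhds (by linarith [hx.1]) (by linarith [hx.2])))
  have hξ01 := hsub (Set.Ioo_subset_Icc_self hξ)
  have hquot : |f' ξ| ≤ 2 * M / h := by
    rw [hslope, add_sub_cancel_left, abs_div, abs_of_pos h0]
    gcongr
    linarith [abs_sub (f (a + h)) (f a), hM a ⟨ha0, by linarith⟩, hM (a + h) ⟨by linarith, hah⟩]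
  have hdist : |t - ξ| ≤ h := abs_le.2 ⟨by linarith [hξ.2], by linarith [hξ.1]⟩
  have hosc : |f' t - f' ξ| ≤ K * h ^ α := (hf' t ht ξ hξ01).trans (by gcongr)
  linarith [abs_sub_abs_le_abs_sub (f' t) (f' ξ)]

/-- **Lemma 7 (interpolation bound on the derivative).** If `f : [0,1] → ℝ` is continuously
differentiable and `f′` is `α`-Hölder with best Hölder constant `K = ‖f′‖_α`, then
`‖f′‖_∞ ≤ 4 max{‖f‖_∞, ‖f‖_∞^{α/(1+α)} K^{1/(1+α)}}`. -/
theorem sup_deriv_le_of_holder_deriv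
    (f f' : ℝ → ℝ) (α : ℝ) (hα : 0 < α) (hα1 : α ≤ 1)
    (hderiv : ∀ t ∈ Set.Icc (0 : ℝ) 1, HasDerivWithinAt f (f' t) (Set.Icc (0 : ℝ) 1) t)
    (hcont : ContinuousOn f' (Set.Icc (0 : ℝ) 1))
    (K : ℝ)
    (hK : IsLeast {L : ℝ | ∀ s ∈ Set.Icc (0 : ℝ) 1, ∀ t ∈ Set.Icc (0 : ℝ) 1,
      |f' s - f' t| ≤ L * |s - t| ^ α} K) :
    (⨆ t : Set.Icc (0 : ℝ) 1, |f' t|)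
      ≤ 4 * max (⨆ t : Set.Icc (0 : ℝ) 1, |f t|)
          ((⨆ t : Set.Icc (0 : ℝ) 1, |f t|) ^ (α / (1 + α)) * K ^ (1 / (1 + α))) := by
  have hK0 : 0 ≤ K := by
    have := (abs_nonneg _).trans (hK.1 1 (by simp) 0 (by simp))
    simpa using this
  have hfc : ContinuousOn f (Set.Icc (0 : ℝ) 1) := fun t ht => (hderiv t ht).continuousWithinAt
  have hbdd : BddAbove (Set.range fun t : Set.Icc (0 : ℝ) 1 => |f t|) := by
    simpa [Set.image_eq_range] using isCompact_Icc.bddAbove_image hfc.abs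
  set M := ⨆ t : Set.Icc (0 : ℝ) 1, |f t|
  have hM : ∀ t ∈ Set.Icc (0 : ℝ) 1, |f t| ≤ M := fun t ht => le_ciSup hbdd ⟨t, ht⟩
  have hM0 : 0 ≤ M := (abs_nonneg _).trans (hM 0 (by simp))
  have : Nonempty (Set.Icc (0 : ℝ) 1) := ⟨0, by simp⟩
  refine ciSup_le fun ⟨t, ht⟩ => ?_
  change |f' t| ≤ _
  have hscale : ∀ h, 0 < h → h ≤ 1 → |f' t| ≤ 2 * M / h + K * h ^ α := fun h h0 h1 =>
    abs_deriv_le_div_add_of_holder hα.le hK0 hderiv hM hK.1 h0 h1 ht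
  rcases le_or_gt K M with hKM | hMK
  · have := hscale 1 one_pos le_rfl
    rw [Real.one_rpow] at this
    linarith [le_max_left M (M ^ (α / (1 + α)) * K ^ (1 / (1 + α)))]
  rcases hM0.eq_or_lt with hMz | hMpos
  · have hzero : ∀ s ∈ Set.Icc (0 : ℝ) 1, f s = 0 := fun s hs =>
      abs_nonpos_iff.1 (hMz ▸ hM s hs)
    have hd : HasDerivWithinAt f 0 (Set.Icc (0 : ℝ) 1) t :=
      (hasDerivWithinAt_const t _ (0 : ℝ)).congr hzero (hzero t ht)
    rw [(uniqueDiffOn_Icc one_pos t ht).eq_deriv _ (hderiv t ht) hd, abs_zero]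
    exact mul_nonneg (by norm_num) (hM0.trans (le_max_left _ _))
  · have hKpos : 0 < K := hMpos.trans hMK
    have hα' : 0 < 1 + α := by linarith
    have hMKpos : 0 < M / K := div_pos hMpos hKpos
    set h := (M / K) ^ (1 / (1 + α)) with hh
    have h0 : 0 < h := Real.rpow_pos_of_pos hMKpos _
    have h1 : h ≤ 1 := Real.rpow_le_one hMKpos.le ((div_le_one hKpos).2 hMK.le) (by positivity)
    have hpow : h * h ^ α = M / K := by
      rw [← Real.rpow_one_add' h0.le hα'.ne', hh, ← Real.rpow_mul hMKpos.le,
        one_div_mul_cancel hα'.ne', Real.rpow_one]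
    have hquot : M / h = K * h ^ α := by
      rw [div_eq_iff h0.ne', mul_assoc, mul_comm (h ^ α), hpow, mul_div_cancel₀ _ hKpos.ne']
    have hbal : K * h ^ α = M ^ (α / (1 + α)) * K ^ (1 / (1 + α)) := by
      have hKsplit : K ^ (1 / (1 + α)) * K ^ (α / (1 + α)) = K := by
        rw [← Real.rpow_add hKpos, ← add_div, div_self hα'.ne', Real.rpow_one]
      have hhα : h ^ α = M ^ (α / (1 + α)) / K ^ (α / (1 + α)) := by
        rw [hh, ← Real.rpow_mul hMKpos.le, one_div_mul_eq_div, Real.div_rpow hMpos.le hKpos.le]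
      rw [hhα, mul_div_assoc', div_eq_iff (Real.rpow_pos_of_pos hKpos _).ne', mul_assoc, hKsplit,
        mul_comm]
    have hle := hscale h h0 h1
    rw [mul_div_assoc, hquot, hbal] at hle
    have hmax := le_max_right M (M ^ (α / (1 + α)) * K ^ (1 / (1 + α)))
    linarith [hM0.trans (le_max_left M (M ^ (α / (1 + α)) * K ^ (1 / (1 + α))))]
end

section
/- Let V_0, V_1, …, V_m be smooth vector fields on ℝⁿ. Define collections of vector fields on ℝⁿ by 𝒱_0 = {V_i : i ≥ 1} and 𝒱_{k+1} = 𝒱_k ∪ {[U, V_j] : U ∈ 𝒱_k, 0 ≤ j ≤ m}, and set 𝒱_k(x) = span{V(x) : V ∈ 𝒱_k}. Define vector fields on ℝ^{n+1} = ℝⁿ × ℝ by V̂_0(x,t) = (V_0(x), 1) and V̂_j(x,t) = (V_j(x), 0) for j = 1,…,m, and define collections 𝒱̂_0 = {V̂_0, V̂_1, …, V̂_m} and 𝒱̂_{k+1} = 𝒱̂_k ∪ {[U, V̂_j] : U ∈ 𝒱̂_k, 0 ≤ j ≤ m}, with 𝒱̂_k(x,t) = span{V(x,t) : V ∈ 𝒱̂_k}.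 Then the parabolic Hörmander condition holds, i.e. ∪_{k≥1} 𝒱_k(x) spans ℝⁿ for every x ∈ ℝⁿ, if and only if ∪_{k≥1} 𝒱̂_k(x,t) spans ℝ^{n+1} for every (x,t) ∈ ℝ^{n+1}. -/
/-- The Lie bracket `[U,V](x) = DV(x)U(x) − DU(x)V(x)` of two vector fields. -/
noncomputable def vfBracket {E : Type*} [NormedAddCommGroup E] [NormedSpace ℝ E]
    (U V : E → E) : E → E :=
  fun x => fderiv ℝ V x (U x) - fderiv ℝ U x (V x)

/-- The collections obtained from an initial collection `S₀` of vector fields by repeatedly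
adjoining brackets with the vector fields `V 0, …, V m`:
`S_{k+1} = S_k ∪ {[U, V j] : U ∈ S_k, 0 ≤ j ≤ m}`. -/
def bracketSets {E : Type*} [NormedAddCommGroup E] [NormedSpace ℝ E]
    {m : ℕ} (V : Fin (m + 1) → E → E) (S₀ : Set (E → E)) : ℕ → Set (E → E)
  | 0 => S₀
  | k + 1 => bracketSets V S₀ k ∪
      {W | ∃ U ∈ bracketSets V S₀ k, ∃ j : Fin (m + 1), W = vfBracket U (V j)}

/-- The space-time vector field `(U, c)` with constant time component `c`. -/
def spacetimeLift {E : Type*} (c : ℝ) (U : E → E) : E × ℝ → E × ℝ :=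
  fun p => (U p.1, c)

section Helpers

variable {E : Type*} [NormedAddCommGroup E] [NormedSpace ℝ E]

theorem fderiv_spacetimeLift {U : E → E} (hU : Differentiable ℝ U) (c : ℝ) (p q : E × ℝ) :
    fderiv ℝ (spacetimeLift c U) p q = (fderiv ℝ U p.1 q.1, 0) := by
  have h : HasFDerivAt (spacetimeLift c U)
      (((fderiv ℝ U p.1).comp (ContinuousLinearMap.fst ℝ E ℝ)).prod 0) p :=
    ((hU p.1).hasFDerivAt.comp p hasFDerivAt_fst).prodMk (hasFDerivAt_const c p)
  rw [h.fderiv]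
  rfl

theorem vfBracket_spacetimeLift {U W : E → E} (hU : Differentiable ℝ U)
    (hW : Differentiable ℝ W) (c d : ℝ) :
    vfBracket (spacetimeLift c U) (spacetimeLift d W) = spacetimeLift 0 (vfBracket U W) := by
  funext p
  rw [vfBracket, fderiv_spacetimeLift hU, fderiv_spacetimeLift hW]
  simp [spacetimeLift, vfBracket]

theorem vfBracket_const_smul (c : ℝ) (U W : E → E) :
    vfBracket (c • U) W = c • vfBracket U W := by
  funext x
  simp [vfBracket, fderiv_const_smul_field, smul_sub]

theorem vfBracket_swap (U W : E → E) : vfBracket U W = (-1 : ℝ) • vfBracket W U := by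
  funext x
  simp [vfBracket]

theorem vfBracket_self (U : E → E) : vfBracket U U = 0 := by
  funext x
  simp [vfBracket]

theorem ContDiff.vfBracket {U W : E → E} (hU : ContDiff ℝ (⊤ : ℕ∞) U)
    (hW : ContDiff ℝ (⊤ : ℕ∞) W) : ContDiff ℝ (⊤ : ℕ∞) (vfBracket U W) :=
  ((hW.fderiv_right (m := (⊤ : ℕ∞)) le_rfl).clm_apply hU).sub
    ((hU.fderiv_right (m := (⊤ : ℕ∞)) le_rfl).clm_apply hW)

theorem contDiff_of_mem_bracketSets {m : ℕ} {V : Fin (m + 1) → E → E} {S : Set (E → E)}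
    (hV : ∀ i, ContDiff ℝ (⊤ : ℕ∞) (V i)) (hS : ∀ W ∈ S, ContDiff ℝ (⊤ : ℕ∞) W) :
    ∀ k, ∀ W ∈ bracketSets V S k, ContDiff ℝ (⊤ : ℕ∞) W := by
  intro k
  induction k with
  | zero => exact hS
  | succ k ih =>
    rintro W (hW | ⟨U, hU, j, rfl⟩)
    · exact ih W hW
    · exact (ih U hU).vfBracket (hV j)

/-- Brackets of lifts with arbitrary constant time components `c j` lift the brackets. -/
theorem spacetimeLift_mem_bracketSets {m : ℕ} {V : Fin (m + 1) → E → E} {S : Set (E → E)}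
    {c : Fin (m + 1) → ℝ} {T : Set (E × ℝ → E × ℝ)}
    (hV : ∀ i, ContDiff ℝ (⊤ : ℕ∞) (V i)) (hS : ∀ W ∈ S, ContDiff ℝ (⊤ : ℕ∞) W)
    (hT : ∀ W ∈ S, spacetimeLift 0 W ∈ T) :
    ∀ k, ∀ W ∈ bracketSets V S k,
      spacetimeLift 0 W ∈ bracketSets (fun j => spacetimeLift (c j) (V j)) T k := by
  intro k
  induction k with
  | zero => exact hT
  | succ k ih =>
    rintro W (hW | ⟨U, hU, j, rfl⟩)
    · exact Or.inl (ih W hW)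
    · refine Or.inr ⟨_, ih U hU, j, ?_⟩
      exact (vfBracket_spacetimeLift
        ((contDiff_of_mem_bracketSets hV hS k U hU).differentiable (by simp))
        ((hV j).differentiable (by simp)) _ _).symm

/-- Every iterated space-time bracket is the drift field itself or the lift, with zero time
component, of a multiple of an iterated spatial bracket. -/
theorem eq_drift_or_spacetimeLift_smul {m : ℕ} {V : Fin (m + 1) → E → E}
    {c : Fin (m + 1) → ℝ} (hc : ∀ j, j ≠ 0 → c j = 0)
    (hV : ∀ i, ContDiff ℝ (⊤ : ℕ∞) (V i)) :
    ∀ k, ∀ W ∈ bracketSets (fun j => spacetimeLift (c j) (V j))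
        (Set.range fun j => spacetimeLift (c j) (V j)) k,
      W = spacetimeLift (c 0) (V 0) ∨
      ∃ (a : ℝ) (U : E → E), ContDiff ℝ (⊤ : ℕ∞) U ∧ W = spacetimeLift 0 (a • U) ∧
        (a = 0 ∨ ∃ l, U ∈ bracketSets V {W | ∃ i : Fin (m + 1), i ≠ 0 ∧ W = V i} l) := by
  intro k
  induction k with
  | zero =>
    rintro W ⟨j, rfl⟩
    by_cases hj : j = 0
    · subst hj
      exact Or.inl rfl
    · exact Or.inr ⟨1, V j, hV j, by simp [hc j hj], Or.inr ⟨0, j, hj, rfl⟩⟩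
  | succ k ih =>
    rintro W (hW | ⟨U, hU, j, rfl⟩)
    · exact ih W hW
    right
    have hd : ∀ i, Differentiable ℝ (V i) := fun i => (hV i).differentiable (by simp)
    rcases ih U hU with rfl | ⟨a, U, hUs, rfl, hmem⟩
    · rw [vfBracket_spacetimeLift (hd 0) (hd j)]
      by_cases hj : j = 0
      · subst hj
        exact ⟨0, V 0, hV 0, by simp [vfBracket_self], Or.inl rfl⟩
      · exact ⟨-1, vfBracket (V j) (V 0), (hV j).vfBracket (hV 0), by rw [vfBracket_swap],
          Or.inr ⟨1, Or.inr ⟨V j, ⟨j, hj, rfl⟩, 0, rfl⟩⟩⟩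
    · refine ⟨a, vfBracket U (V j), hUs.vfBracket (hV j), ?_, ?_⟩
      · rw [vfBracket_spacetimeLift ((hUs.differentiable (by simp)).const_smul a) (hd j),
          vfBracket_const_smul]
      · exact hmem.imp_right fun ⟨l, hl⟩ => ⟨l + 1, Or.inr ⟨U, hl, j, rfl⟩⟩

end Helpers

/-- **Equivalence of the parabolic Hörmander condition with its space-time version.**
With `𝒱₀ = {V_i : i ≥ 1}`, `𝒱_{k+1} = 𝒱_k ∪ {[U,V_j]}`, and the space-time fields
`V̂_0 = (V_0, 1)`, `V̂_j = (V_j, 0)` with `𝒱̂₀ = {V̂_0,…,V̂_m}`, the spaces `∪_{k≥1} 𝒱_k(x)`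
span `ℝⁿ` for every `x` iff the spaces `∪_{k≥1} 𝒱̂_k(x,t)` span `ℝ^{n+1}` for every `(x,t)`. -/
theorem parabolic_hormander_iff_spacetime
    (n m : ℕ) (V : Fin (m + 1) → (Fin n → ℝ) → (Fin n → ℝ))
    (hV : ∀ i, ContDiff ℝ (⊤ : ℕ∞) (V i))
    (Vhat : Fin (m + 1) → ((Fin n → ℝ) × ℝ) → ((Fin n → ℝ) × ℝ))
    (hVhat0 : ∀ p, Vhat 0 p = (V 0 p.1, 1))
    (hVhatj : ∀ j : Fin (m + 1), j ≠ 0 → ∀ p, Vhat j p = (V j p.1, 0)) :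
    (∀ x : Fin n → ℝ,
        Submodule.span ℝ {v : Fin n → ℝ | ∃ k : ℕ, 1 ≤ k ∧
          ∃ W ∈ bracketSets V {W | ∃ i : Fin (m + 1), i ≠ 0 ∧ W = V i} k, W x = v} = ⊤)
    ↔ (∀ p : (Fin n → ℝ) × ℝ,
        Submodule.span ℝ {v : (Fin n → ℝ) × ℝ | ∃ k : ℕ, 1 ≤ k ∧
          ∃ W ∈ bracketSets Vhat (Set.range Vhat) k, W p = v} = ⊤) := by
  obtain ⟨c, hc0, hc⟩ : ∃ c : Fin (m + 1) → ℝ, c 0 = 1 ∧ ∀ j, j ≠ 0 → c j = 0 :=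
    ⟨Pi.single 0 1, by simp, fun j hj => by simp [hj]⟩
  obtain rfl : Vhat = fun j => spacetimeLift (c j) (V j) := by
    funext j p
    by_cases hj : j = 0
    · subst hj
      simp [hVhat0, spacetimeLift, hc0]
    · simp [hVhatj j hj, spacetimeLift, hc j hj]
  constructor
  · rintro h ⟨x, t⟩
    rw [eq_top_iff]
    rintro ⟨v, s⟩ -
    set T := Submodule.span ℝ {v : (Fin n → ℝ) × ℝ | ∃ k : ℕ, 1 ≤ k ∧
      ∃ W ∈ bracketSets (fun j => spacetimeLift (c j) (V j))
        (Set.range fun j => spacetimeLift (c j) (V j)) k, W (x, t) = v}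
    have hdrift : (V 0 x, (1 : ℝ)) ∈ T :=
      Submodule.subset_span
        ⟨1, le_rfl, spacetimeLift (c 0) (V 0), Or.inl ⟨0, rfl⟩, by simp [spacetimeLift, hc0]⟩
    have hspace : ∀ w : Fin n → ℝ, (w, (0 : ℝ)) ∈ T := by
      suffices hle : (⊤ : Submodule ℝ (Fin n → ℝ)) ≤ T.comap (LinearMap.inl ℝ (Fin n → ℝ) ℝ) from
        fun w => hle (Submodule.mem_top (x := w))
      rw [← h x, Submodule.span_le]
      rintro _ ⟨k, hk, W, hW, rfl⟩
      refine Submodule.subset_span ⟨k, hk, spacetimeLift 0 W, ?_, rfl⟩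
      refine spacetimeLift_mem_bracketSets hV ?_ ?_ k W hW
      · rintro _ ⟨i, -, rfl⟩
        exact hV i
      · rintro _ ⟨i, hi, rfl⟩
        exact ⟨i, by simp [hc i hi]⟩
    have hsum := T.add_mem (T.smul_mem s hdrift) (hspace (v - s • V 0 x))
    simpa using hsum
  · intro h x
    rw [eq_top_iff]
    rintro v -
    set T := Submodule.span ℝ {v : Fin n → ℝ | ∃ k : ℕ, 1 ≤ k ∧
      ∃ W ∈ bracketSets V {W | ∃ i : Fin (m + 1), i ≠ 0 ∧ W = V i} k, W x = v}
    let L : (Fin n → ℝ) × ℝ →ₗ[ℝ] (Fin n → ℝ) :=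
      LinearMap.fst ℝ _ _ - (LinearMap.snd ℝ _ _).smulRight (V 0 x)
    have hle : (⊤ : Submodule ℝ ((Fin n → ℝ) × ℝ)) ≤ T.comap L := by
      rw [← h (x, 0), Submodule.span_le]
      rintro _ ⟨k, -, W, hW, rfl⟩
      rcases eq_drift_or_spacetimeLift_smul hc hV k W hW with rfl | ⟨a, U, -, rfl, rfl | ⟨l, hl⟩⟩
      · simp [L, spacetimeLift, hc0]
      · simp [L, spacetimeLift]
      · have hU : U x ∈ T := Submodule.subset_span ⟨l + 1, by simp, U, Or.inl hl, rfl⟩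
        simpa [L, spacetimeLift] using T.smul_mem a hU
    simpa [L] using hle (Submodule.mem_top (x := (v, (0 : ℝ))))
end

section
/- Let U, V : ℝⁿ → ℝⁿ be smooth, bounded vector fields with bounded derivatives of all orders, and let x₀ ∈ ℝⁿ. For each n ≥ 1 set u_n(t) = n^{-1} cos(n² t) and v_n(t) = n^{-1} sin(n² t), and let x_n : [0,∞) → ℝⁿ be the solution of the ODE x_n′(t) = U(x_n(t)) u_n′(t) + V(x_n(t)) v_n′(t) with x_n(0) = x₀. Let y : [0,∞) → ℝⁿ be the solution of y′(t) = ½ [U,V](y(t)) with y(0) = x₀, where [U,V](x) = DV(x)U(x) − DU(x)V(x). Then for every T > 0, x_n converges to y uniformly on [0,T] as n → ∞. -/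
/-- `f` is differentiable, and both `f` and its derivative are bounded. -/
def BoundedC1 {E F : Type*} [NormedAddCommGroup E] [NormedSpace ℝ E] [NormedAddCommGroup F]
    [NormedSpace ℝ F] (f : E → F) : Prop :=
  Differentiable ℝ f ∧ ∃ C : ℝ, ∀ x, ‖f x‖ ≤ C ∧ ‖fderiv ℝ f x‖ ≤ C

namespace BoundedC1

variable {E F G : Type*} [NormedAddCommGroup E] [NormedSpace ℝ E] [NormedAddCommGroup F]
  [NormedSpace ℝ F] [NormedAddCommGroup G] [NormedSpace ℝ G]

theorem eventually_bound {f : E → F} (hf : BoundedC1 f) :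
    ∀ᶠ C : ℝ in Filter.atTop, ∀ x, ‖f x‖ ≤ C ∧ ‖fderiv ℝ f x‖ ≤ C := by
  obtain ⟨C, hC⟩ := hf.2
  filter_upwards [Filter.eventually_ge_atTop C] with D hD x
  exact ⟨(hC x).1.trans hD, (hC x).2.trans hD⟩

theorem add {f g : E → F} (hf : BoundedC1 f) (hg : BoundedC1 g) :
    BoundedC1 (fun x => f x + g x) := by
  obtain ⟨hfd, C, hC⟩ := hf
  obtain ⟨hgd, D, hD⟩ := hg
  refine ⟨hfd.add hgd, C + D, fun x => ⟨norm_add_le_of_le (hC x).1 (hD x).1, ?_⟩⟩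
  rw [fderiv_fun_add (hfd x) (hgd x)]
  exact norm_add_le_of_le (hC x).2 (hD x).2

theorem const_smul {f : E → F} (hf : BoundedC1 f) (a : ℝ) : BoundedC1 (fun x => a • f x) := by
  obtain ⟨hfd, C, hC⟩ := hf
  refine ⟨hfd.const_smul a, ‖a‖ * C, fun x => ⟨?_, ?_⟩⟩
  · rw [norm_smul]
    exact mul_le_mul_of_nonneg_left (hC x).1 (norm_nonneg a)
  · rw [fderiv_fun_const_smul (hfd x), norm_smul]
    exact mul_le_mul_of_nonneg_left (hC x).2 (norm_nonneg a)

theorem sub {f g : E → F} (hf : BoundedC1 f) (hg : BoundedC1 g) :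
    BoundedC1 (fun x => f x - g x) := by
  simpa [sub_eq_add_neg] using hf.add (hg.const_smul (-1))

theorem clm_apply {A : E → F →L[ℝ] G} {g : E → F} (hA : BoundedC1 A) (hg : BoundedC1 g) :
    BoundedC1 (fun x => A x (g x)) := by
  obtain ⟨hAd, C, hC⟩ := hA
  obtain ⟨hgd, D, hD⟩ := hg
  refine ⟨hAd.clm_apply hgd, C * D + C * D, fun x => ?_⟩
  have hC0 : 0 ≤ C := (norm_nonneg _).trans (hC x).1
  have hD0 : 0 ≤ D := (norm_nonneg _).trans (hD x).1
  constructor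
  · calc ‖A x (g x)‖ ≤ C * D := (A x).le_of_opNorm_le_of_le (hC x).1 (hD x).1
      _ ≤ C * D + C * D := le_add_of_nonneg_left (by positivity)
  · rw [fderiv_clm_apply (hAd x) (hgd x)]
    refine norm_add_le_of_le ((ContinuousLinearMap.opNorm_comp_le _ _).trans ?_) ?_
    · exact mul_le_mul (hC x).1 (hD x).2 (norm_nonneg _) hC0
    · refine ContinuousLinearMap.opNorm_le_bound _ (by positivity) fun h => ?_
      rw [ContinuousLinearMap.flip_apply]
      calc ‖fderiv ℝ A x h (g x)‖ ≤ (C * ‖h‖) * D :=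
            ContinuousLinearMap.le_of_opNorm_le_of_le _
              ((fderiv ℝ A x).le_of_opNorm_le (hC x).2 h) (hD x).1
        _ = C * D * ‖h‖ := by ring

theorem of_iteratedFDeriv {f : E → F} (hf : Differentiable ℝ f)
    (h₀ : ∃ C : ℝ, ∀ x, ‖iteratedFDeriv ℝ 0 f x‖ ≤ C)
    (h₁ : ∃ C : ℝ, ∀ x, ‖iteratedFDeriv ℝ 1 f x‖ ≤ C) : BoundedC1 f := by
  obtain ⟨C, hC⟩ := h₀
  obtain ⟨D, hD⟩ := h₁
  refine ⟨hf, max C D, fun x => ⟨?_, ?_⟩⟩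
  · rw [← norm_iteratedFDeriv_zero (𝕜 := ℝ)]
    exact (hC x).trans (le_max_left _ _)
  · rw [← norm_iteratedFDeriv_one]
    exact (hD x).trans (le_max_right _ _)

theorem fderiv_of_iteratedFDeriv {f : E → F} (hf : ContDiff ℝ 2 f)
    (h : ∀ k : ℕ, ∃ C : ℝ, ∀ x, ‖iteratedFDeriv ℝ k f x‖ ≤ C) : BoundedC1 (fderiv ℝ f) := by
  refine of_iteratedFDeriv ((hf.fderiv_right (m := 1) (by norm_num)).differentiable (by norm_num))
    ?_ ?_
  · simpa only [norm_iteratedFDeriv_fderiv] using h 1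
  · simpa only [norm_iteratedFDeriv_fderiv] using h 2

end BoundedC1

section Averaging

variable {E : Type*} [NormedAddCommGroup E] [NormedSpace ℝ E]

/-- The corrected trajectory, obtained from the position `x` at time `t` by removing the
oscillating terms of first and second order. -/
noncomputable def averagedPosition (U V : E → E) (ν t : ℝ) (x : E) : E :=
  x - (ν⁻¹ * Real.cos (ν ^ 2 * t)) • U x - (ν⁻¹ * Real.sin (ν ^ 2 * t)) • V x
    + ((4 * ν ^ 2)⁻¹ * Real.cos (2 * (ν ^ 2 * t))) • (fderiv ℝ U x (U x) - fderiv ℝ V x (V x))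
    + ((4 * ν ^ 2)⁻¹ * Real.sin (2 * (ν ^ 2 * t))) • (fderiv ℝ U x (V x) + fderiv ℝ V x (U x))

theorem norm_averagedPosition_sub_le {U V : E → E} {C ν : ℝ} (hν : 1 ≤ ν) (t : ℝ) (x : E)
    (hU : ‖U x‖ ≤ C) (hV : ‖V x‖ ≤ C)
    (hP : ‖fderiv ℝ U x (U x) - fderiv ℝ V x (V x)‖ ≤ C)
    (hQ : ‖fderiv ℝ U x (V x) + fderiv ℝ V x (U x)‖ ≤ C) :
    ‖averagedPosition U V ν t x - x‖ ≤ 4 * C / ν := by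
  have hν0 : 0 < ν := by linarith
  have hinv : (4 * ν ^ 2)⁻¹ ≤ ν⁻¹ := by
    apply inv_anti₀ hν0
    nlinarith
  have key : ∀ (a r : ℝ) (w : E), 0 ≤ a → a ≤ ν⁻¹ → |r| ≤ 1 → ‖w‖ ≤ C →
      ‖(a * r) • w‖ ≤ C / ν := by
    intro a r w ha haν hr hw
    have hC : 0 ≤ C := (norm_nonneg w).trans hw
    rw [norm_smul, Real.norm_eq_abs, abs_mul, abs_of_nonneg ha]
    calc a * |r| * ‖w‖ ≤ ν⁻¹ * 1 * C := by gcongr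
      _ = C / ν := by ring
  have h1 := key ν⁻¹ _ (U x) (by positivity) le_rfl (Real.abs_cos_le_one (ν ^ 2 * t)) hU
  have h2 := key ν⁻¹ _ (V x) (by positivity) le_rfl (Real.abs_sin_le_one (ν ^ 2 * t)) hV
  have h3 := key (4 * ν ^ 2)⁻¹ _ _ (by positivity) hinv (Real.abs_cos_le_one (2 * (ν ^ 2 * t))) hP
  have h4 := key (4 * ν ^ 2)⁻¹ _ _ (by positivity) hinv (Real.abs_sin_le_one (2 * (ν ^ 2 * t))) hQ
  rw [← norm_neg] at h1 h2
  have := norm_add_le_of_le (norm_add_le_of_le (norm_add_le_of_le h1 h2) h3) h4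
  refine le_trans (le_of_eq ?_) (this.trans (le_of_eq (by ring)))
  unfold averagedPosition
  congr 1
  abel

theorem hasDerivWithinAt_averagedPosition {U V : E → E} {ν t : ℝ} {x : ℝ → E} {s : Set ℝ}
    (hν : ν ≠ 0) (hU : Differentiable ℝ U) (hV : Differentiable ℝ V)
    (hP : Differentiable ℝ fun z => fderiv ℝ U z (U z) - fderiv ℝ V z (V z))
    (hQ : Differentiable ℝ fun z => fderiv ℝ U z (V z) + fderiv ℝ V z (U z))
    {X : E} (hX : X = (-ν * Real.sin (ν ^ 2 * t)) • U (x t) + (ν * Real.cos (ν ^ 2 * t)) • V (x t))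
    (hx : HasDerivWithinAt x X s t) :
    HasDerivWithinAt (fun t => averagedPosition U V ν t (x t))
      ((1 / 2 : ℝ) • (fderiv ℝ V (x t) (U (x t)) - fderiv ℝ U (x t) (V (x t)))
        + (((4 * ν ^ 2)⁻¹ * Real.cos (2 * (ν ^ 2 * t))) •
            fderiv ℝ (fun z => fderiv ℝ U z (U z) - fderiv ℝ V z (V z)) (x t) X
          + ((4 * ν ^ 2)⁻¹ * Real.sin (2 * (ν ^ 2 * t))) •
            fderiv ℝ (fun z => fderiv ℝ U z (V z) + fderiv ℝ V z (U z)) (x t) X)) s t := by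
  have hθ : HasDerivWithinAt (fun t : ℝ => ν ^ 2 * t) (ν ^ 2) s t := by
    simpa using (hasDerivWithinAt_id t s).const_mul (ν ^ 2)
  have hθ_double := hθ.const_mul 2
  have comp : ∀ {f : E → E}, Differentiable ℝ f →
      HasDerivWithinAt (fun t => f (x t)) (fderiv ℝ f (x t) X) s t := fun hf =>
    (hf (x t)).hasFDerivAt.comp_hasDerivWithinAt t hx
  have h := (((hx.sub ((hθ.cos.const_mul ν⁻¹).fun_smul (comp hU))).sub
    ((hθ.sin.const_mul ν⁻¹).fun_smul (comp hV))).add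
    ((hθ_double.cos.const_mul (4 * ν ^ 2)⁻¹).fun_smul (comp hP))).add
    ((hθ_double.sin.const_mul (4 * ν ^ 2)⁻¹).fun_smul (comp hQ))
  refine h.congr_deriv ?_
  generalize fderiv ℝ (fun z => fderiv ℝ U z (U z) - fderiv ℝ V z (V z)) (x t) X = DP
  generalize fderiv ℝ (fun z => fderiv ℝ U z (V z) + fderiv ℝ V z (U z)) (x t) X = DQ
  subst hX
  simp only [map_add, map_smul, Real.cos_two_mul, Real.sin_two_mul]
  have hsc := Real.sin_sq (ν ^ 2 * t)
  generalize Real.sin (ν ^ 2 * t) = σ at *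
  generalize Real.cos (ν ^ 2 * t) = c at *
  match_scalars <;> field_simp <;> grind

theorem norm_averaging_error_le {C ν α β : ℝ} (hν : 0 < ν) (hα : |α| ≤ 1) (hβ : |β| ≤ 1)
    {a b : ℝ} (ha : |a| ≤ 1) (hb : |b| ≤ 1) {u v X : E} {P Q : E →L[ℝ] E}
    (hX : X = (-ν * a) • u + (ν * b) • v)
    (hu : ‖u‖ ≤ C) (hv : ‖v‖ ≤ C) (hP : ‖P‖ ≤ C) (hQ : ‖Q‖ ≤ C) :
    ‖((4 * ν ^ 2)⁻¹ * α) • P X + ((4 * ν ^ 2)⁻¹ * β) • Q X‖ ≤ C ^ 2 / ν := by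
  have hC : 0 ≤ C := (norm_nonneg u).trans hu
  have hXn : ‖X‖ ≤ 2 * ν * C := by
    rw [hX]
    refine (norm_add_le _ _).trans ?_
    rw [norm_smul, norm_smul, Real.norm_eq_abs, Real.norm_eq_abs, abs_mul, abs_mul, abs_neg,
      abs_of_pos hν]
    calc ν * |a| * ‖u‖ + ν * |b| * ‖v‖ ≤ ν * 1 * C + ν * 1 * C := by gcongr
      _ = 2 * ν * C := by ring
  have key : ∀ (r : ℝ) (A : E →L[ℝ] E), |r| ≤ 1 → ‖A‖ ≤ C →
      ‖((4 * ν ^ 2)⁻¹ * r) • A X‖ ≤ C ^ 2 / (2 * ν) := by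
    intro r A hr hA
    rw [norm_smul, Real.norm_eq_abs, abs_mul, abs_of_pos (by positivity : 0 < (4 * ν ^ 2)⁻¹)]
    calc (4 * ν ^ 2)⁻¹ * |r| * ‖A X‖ ≤ (4 * ν ^ 2)⁻¹ * 1 * (C * (2 * ν * C)) := by
          gcongr
          exact A.le_of_opNorm_le_of_le hA hXn
      _ = C ^ 2 / (2 * ν) := by field_simp; ring
  refine (norm_add_le_of_le (key α P hα hP) (key β Q hβ hQ)).trans (le_of_eq ?_)
  field_simp
  ring

theorem dist_oscillation_lie_bracket_flow_le {U V : E → E} (hU : BoundedC1 U) (hV : BoundedC1 V)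
    (hDU : BoundedC1 (fderiv ℝ U)) (hDV : BoundedC1 (fderiv ℝ V)) :
    ∃ C : ℝ, ∀ (ν : ℝ) (x y : ℝ → E), 1 ≤ ν → x 0 = y 0 →
      (∀ t ∈ Set.Ici (0 : ℝ), HasDerivWithinAt x
        ((-ν * Real.sin (ν ^ 2 * t)) • U (x t) + (ν * Real.cos (ν ^ 2 * t)) • V (x t))
        (Set.Ici (0 : ℝ)) t) →
      (∀ t ∈ Set.Ici (0 : ℝ), HasDerivWithinAt y
        ((1 / 2 : ℝ) • (fderiv ℝ V (y t) (U (y t)) - fderiv ℝ U (y t) (V (y t))))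
        (Set.Ici (0 : ℝ)) t) →
      ∀ t ∈ Set.Ici (0 : ℝ), dist (x t) (y t) ≤ 13 * C * Real.exp (C * t) / ν := by
  have hP := (hDU.clm_apply hU).sub (hDV.clm_apply hV)
  have hQ := (hDU.clm_apply hV).add (hDV.clm_apply hU)
  have hB := ((hDV.clm_apply hU).sub (hDU.clm_apply hV)).const_smul (1 / 2)
  obtain ⟨C, hC1, hCU, hCV, hCP, hCQ, hCB⟩ :=
    ((Filter.eventually_ge_atTop (1 : ℝ)).and (hU.eventually_bound.and (hV.eventually_bound.and
      (hP.eventually_bound.and (hQ.eventually_bound.and hB.eventually_bound))))).exists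
  have hC0 : 0 < C := by linarith
  lift C to NNReal using hC0.le
  have hlip := lipschitzWith_of_nnnorm_fderiv_le hB.1 fun x => (hCB x).2
  refine ⟨C, fun ν x y hν h0 hx hy t ht => ?_⟩
  have hν0 : 0 < ν := by linarith
  set w : ℝ → E := fun t => averagedPosition U V ν t (x t)
  have hwx : ∀ t, dist (w t) (x t) ≤ 4 * C / ν := fun t => by
    rw [dist_eq_norm]
    exact norm_averagedPosition_sub_le hν t (x t) (hCU _).1 (hCV _).1 (hCP _).1 (hCQ _).1
  have hderiv := fun t ht =>
    hasDerivWithinAt_averagedPosition hν0.ne' hU.1 hV.1 hP.1 hQ.1 rfl (hx t ht)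
  have gron := dist_le_of_approx_trajectories_ODE (a := 0) (b := t) (K := C)
    (v := fun _ z => (1 / 2 : ℝ) • (fderiv ℝ V z (U z) - fderiv ℝ U z (V z)))
    (f := w) (g := y) (εf := 5 * C ^ 2 / ν) (εg := 0) (δ := 4 * C / ν)
    (fun _ => hlip)
    (fun r hr => ((hderiv r hr.1).continuousWithinAt).mono Set.Icc_subset_Ici_self)
    (fun r hr => (hderiv r hr.1).mono (Set.Ici_subset_Ici.2 hr.1))
    (fun r hr => ?_)
    (fun r hr => ((hy r hr.1).continuousWithinAt).mono Set.Icc_subset_Ici_self)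
    (fun r hr => (hy r hr.1).mono (Set.Ici_subset_Ici.2 hr.1))
    (fun r _ => (dist_self _).le)
    (h0 ▸ hwx 0) t ⟨ht, le_rfl⟩
  · rw [gronwallBound_of_K_ne_0 hC0.ne', add_zero, sub_zero] at gron
    have hexp : 1 ≤ Real.exp (C * t) := Real.one_le_exp (mul_nonneg hC0.le ht)
    calc dist (x t) (y t) ≤ dist (w t) (x t) + dist (w t) (y t) := dist_triangle_left _ _ _
      _ ≤ 4 * C / ν + (4 * C / ν * Real.exp (C * t)
          + 5 * C ^ 2 / ν / C * (Real.exp (C * t) - 1)) := add_le_add (hwx t) gron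
      _ = (4 * C + 4 * C * Real.exp (C * t) + 5 * C * (Real.exp (C * t) - 1)) / ν := by
          field_simp
          ring
      _ ≤ 13 * C * Real.exp (C * t) / ν := by
          gcongr
          nlinarith
  · refine (dist_triangle_right _ _
      ((1 / 2 : ℝ) • (fderiv ℝ V (x r) (U (x r)) - fderiv ℝ U (x r) (V (x r))))).trans ?_
    have h1 := norm_averaging_error_le hν0 (Real.abs_cos_le_one (2 * (ν ^ 2 * r)))
      (Real.abs_sin_le_one (2 * (ν ^ 2 * r))) (Real.abs_sin_le_one (ν ^ 2 * r))
      (Real.abs_cos_le_one (ν ^ 2 * r)) rfl (hCU (x r)).1 (hCV (x r)).1 (hCP (x r)).2 (hCQ (x r)).2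
    have h2 := (hlip.dist_le_mul (w r) (x r)).trans
      (mul_le_mul_of_nonneg_left (hwx r) C.coe_nonneg)
    rw [dist_eq_norm, add_sub_cancel_left]
    refine (add_le_add h1 h2).trans (le_of_eq ?_)
    ring

end Averaging


/-- **Oscillatory motions generate the Lie bracket.** Let `U, V` be smooth bounded vector
fields with bounded derivatives of all orders, and for `ν ≥ 1` let `x_ν` solve
`x_ν′ = U(x_ν) u_ν′ + V(x_ν) v_ν′` on `[0,∞)` with `x_ν(0) = x₀`, where
`u_ν(t) = ν⁻¹ cos(ν² t)`, `v_ν(t) = ν⁻¹ sin(ν² t)` (so `u_ν′(t) = −ν sin(ν² t)`,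
`v_ν′(t) = ν cos(ν² t)`). Let `y` solve `y′ = ½ [U,V](y)`, `y(0) = x₀`. Then `x_ν → y`
uniformly on `[0,T]` for every `T > 0`. -/
theorem oscillation_tendsto_lie_bracket_flow
    (d : ℕ) (U V : EuclideanSpace ℝ (Fin d) → EuclideanSpace ℝ (Fin d))
    (hU : ContDiff ℝ (⊤ : ℕ∞) U) (hV : ContDiff ℝ (⊤ : ℕ∞) V)
    (hUbdd : ∀ k : ℕ, ∃ C : ℝ, ∀ x, ‖iteratedFDeriv ℝ k U x‖ ≤ C)
    (hVbdd : ∀ k : ℕ, ∃ C : ℝ, ∀ x, ‖iteratedFDeriv ℝ k V x‖ ≤ C)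
    (x₀ : EuclideanSpace ℝ (Fin d))
    (x : ℕ → ℝ → EuclideanSpace ℝ (Fin d))
    (hx0 : ∀ ν : ℕ, 1 ≤ ν → x ν 0 = x₀)
    (hxODE : ∀ ν : ℕ, 1 ≤ ν → ∀ t ∈ Set.Ici (0 : ℝ),
      HasDerivWithinAt (x ν)
        ((-(ν : ℝ) * Real.sin ((ν : ℝ) ^ 2 * t)) • U (x ν t)
          + ((ν : ℝ) * Real.cos ((ν : ℝ) ^ 2 * t)) • V (x ν t))
        (Set.Ici (0 : ℝ)) t)
    (y : ℝ → EuclideanSpace ℝ (Fin d)) (hy0 : y 0 = x₀)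
    (hyODE : ∀ t ∈ Set.Ici (0 : ℝ),
      HasDerivWithinAt y
        ((1 / 2 : ℝ) • (fderiv ℝ V (y t) (U (y t)) - fderiv ℝ U (y t) (V (y t))))
        (Set.Ici (0 : ℝ)) t) :
    ∀ T : ℝ, 0 < T →
      TendstoUniformlyOn (fun ν t => x ν t) y Filter.atTop (Set.Icc 0 T) := by
  intro T _
  obtain ⟨C, hC⟩ := dist_oscillation_lie_bracket_flow_le
    (BoundedC1.of_iteratedFDeriv (hU.differentiable (by simp)) (hUbdd 0) (hUbdd 1))
    (BoundedC1.of_iteratedFDeriv (hV.differentiable (by simp)) (hVbdd 0) (hVbdd 1))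
    (BoundedC1.fderiv_of_iteratedFDeriv (contDiff_infty.1 hU 2) hUbdd)
    (BoundedC1.fderiv_of_iteratedFDeriv (contDiff_infty.1 hV 2) hVbdd)
  rw [Metric.tendstoUniformlyOn_iff]
  intro ε hε
  have hlim : Filter.Tendsto (fun ν : ℕ => 13 * |C| * Real.exp (|C| * T) / (ν : ℝ)) Filter.atTop
      (nhds 0) := tendsto_const_div_atTop_nhds_zero_nat _
  filter_upwards [hlim.eventually_lt_const hε, Filter.eventually_ge_atTop 1] with ν hlt hν t ht
  have hν1 : (1 : ℝ) ≤ ν := by exact_mod_cast hν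
  rw [dist_comm]
  refine lt_of_le_of_lt ?_ hlt
  refine (hC ν (x ν) y hν1 ((hx0 ν hν).trans hy0.symm) (hxODE ν hν) hyODE t ht.1).trans ?_
  have ht0 := ht.1
  have htT := ht.2
  gcongr
  · exact le_abs_self C
  · exact le_abs_self C
end
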